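/- arXiv:math/0112155 — 3 statements merged into one kernel-verified Lean document; each statement's English description precedes it below -/
import Mathlib

section
/- The multiplication map V₋ ⊗ V₀ ⊗ V₊ → B is surjective; equivalently, every element of B = O_q(Gr(r,N)) is a linear combination of monomials v₋ v₀ v₊ where v₋, v₀, v₊ are (possibly empty) products of generators z_ij with i > j, i = j, and i < j respectively. -/
noncomputable section

open scoped TensorProduct

/-- The entries `R̂^{ij}_{kl}` of the `R̂`-matrix of the vector representation of
`U_q(sl_N)`:  `R̂^{ij}_{kl} = q^{δ_{ij}} δ_{il} δ_{jk} + (q - q⁻¹) θ(i<j) δ_{ik} δ_{jl}`. -/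
def Rhat (q : ℝ) (i j k l : ℕ) : ℂ :=
  (if i = l ∧ j = k then (q : ℂ) ^ (if i = j then (1 : ℤ) else 0) else 0) +
  (if i = k ∧ j = l ∧ i < j then ((q : ℂ) - (q : ℂ)⁻¹) else 0)

/-- The defining relations of the quantum Grassmannian `O_q(Gr(r,N))` for a candidate
family of generators `z_{ij}`: the reflection-equation relations, the trace relation
`Σ_i z_{ii} = (1 - q^{-2s})/(q - q⁻¹)` (`s = N - r`), and the projector relation
`q^{2N+1} Σ_n q^{-2n} z_{in} z_{nk} = z_{ik}`. -/
def GrassRels (q : ℝ) (N r : ℕ) {V : Type} [Ring V] [Algebra ℂ V]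
    (z : ℕ → ℕ → V) : Prop :=
  (∀ a ∈ Finset.Icc 1 N, ∀ b ∈ Finset.Icc 1 N, ∀ c ∈ Finset.Icc 1 N, ∀ d ∈ Finset.Icc 1 N,
    (∑ i ∈ Finset.Icc 1 N, ∑ j ∈ Finset.Icc 1 N, ∑ k ∈ Finset.Icc 1 N, ∑ l ∈ Finset.Icc 1 N,
      ((q : ℂ) ^ (2 * (b : ℤ) - 2 * (j : ℤ)) * Rhat q k b j l * Rhat q i l c d) •
        (z i j * z k a)) =
    (∑ i ∈ Finset.Icc 1 N, ∑ j ∈ Finset.Icc 1 N, ∑ k ∈ Finset.Icc 1 N, ∑ l ∈ Finset.Icc 1 N,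
      ((q : ℂ) ^ (2 * (l : ℤ) - 2 * (i : ℤ)) * Rhat q j l i d * Rhat q a b k l) •
        (z c i * z j k))) ∧
  ((∑ i ∈ Finset.Icc 1 N, z i i) =
    algebraMap ℂ V ((1 - (q : ℂ) ^ (-(2 : ℤ) * ((N : ℤ) - (r : ℤ)))) /
      ((q : ℂ) - (q : ℂ)⁻¹))) ∧
  (∀ i ∈ Finset.Icc 1 N, ∀ k ∈ Finset.Icc 1 N,
    ((q : ℂ) ^ (2 * (N : ℤ) + 1)) •
        ∑ n ∈ Finset.Icc 1 N, ((q : ℂ) ^ (-(2 : ℤ) * (n : ℤ))) • (z i n * z n k) =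
      z i k)

/-- The quantum Grassmannian `B = O_q(Gr(r,N))`, presented by the generators `z_{ij}`
(`i,j = 1,…,N`) and the relations `GrassRels`, together with its counit. -/
structure QGrassData (q : ℝ) (N r : ℕ) where
  B : Type
  [instRing : Ring B]
  [instAlg : Algebra ℂ B]
  z : ℕ → ℕ → B
  rels : GrassRels q N r z
  counit : B →ₐ[ℂ] ℂ
  counit_z : ∀ i ∈ Finset.Icc 1 N, ∀ j ∈ Finset.Icc 1 N,
    counit (z i j) = if i = j ∧ r < i then (q : ℂ) ^ (2 * (i : ℤ) - (2 * (N : ℤ) + 1)) else 0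
  gen : Algebra.adjoin ℂ
      {x : B | ∃ i ∈ Finset.Icc 1 N, ∃ j ∈ Finset.Icc 1 N, x = z i j} = ⊤
  univ : ∀ (V : Type) [Ring V] [Algebra ℂ V] (w : ℕ → ℕ → V), GrassRels q N r w →
      ∃ φ : B →ₐ[ℂ] V, ∀ i ∈ Finset.Icc 1 N, ∀ j ∈ Finset.Icc 1 N, φ (z i j) = w i j

attribute [instance] QGrassData.instRing QGrassData.instAlg

namespace QGrassData

variable {q : ℝ} {N r : ℕ} (G : QGrassData q N r)

/-- The augmentation ideal `B⁺ = B ∩ ker ε`, as a `ℂ`-subspace of `B`. -/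
def Bp : Submodule ℂ G.B := LinearMap.ker G.counit.toLinearMap

end QGrassData

/-- The sum of `R̂^{ij}_{kl}` against a function of its lower indices. -/
theorem sum_Rhat_lower {W : Type*} [AddCommGroup W] [Module ℂ W] (q : ℝ) (s : Finset ℕ)
    {i j : ℕ} (hi : i ∈ s) (hj : j ∈ s) (g : ℕ → ℕ → W) :
    ∑ k ∈ s, ∑ l ∈ s, Rhat q i j k l • g k l =
      (q : ℂ) ^ (if i = j then (1 : ℤ) else 0) • g j i +
        (if i < j then (q : ℂ) - (q : ℂ)⁻¹ else 0) • g i j := by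
  simp only [Rhat, add_smul, Finset.sum_add_distrib]
  congr 1
  · rw [Finset.sum_eq_single_of_mem j hj, Finset.sum_eq_single_of_mem i hi]
    · simp
    · intro l _ hl
      rw [if_neg (by tauto), zero_smul]
    · intro k _ hk
      exact Finset.sum_eq_zero fun l _ => by rw [if_neg (by tauto), zero_smul]
  · rw [Finset.sum_eq_single_of_mem i hi, Finset.sum_eq_single_of_mem j hj]
    · simp
    · intro l _ hl
      rw [if_neg (by tauto), zero_smul]
    · intro k _ hk
      exact Finset.sum_eq_zero fun l _ => by rw [if_neg (by tauto), zero_smul]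

/-- The sum of `R̂^{ij}_{kl}` against a function of its upper indices. -/
theorem sum_Rhat_upper {W : Type*} [AddCommGroup W] [Module ℂ W] (q : ℝ) (s : Finset ℕ)
    {k l : ℕ} (hk : k ∈ s) (hl : l ∈ s) (g : ℕ → ℕ → W) :
    ∑ i ∈ s, ∑ j ∈ s, Rhat q i j k l • g i j =
      (q : ℂ) ^ (if k = l then (1 : ℤ) else 0) • g l k +
        (if k < l then (q : ℂ) - (q : ℂ)⁻¹ else 0) • g k l := by
  simp only [Rhat, add_smul, Finset.sum_add_distrib]
  congr 1
  · rw [Finset.sum_eq_single_of_mem l hl, Finset.sum_eq_single_of_mem k hk]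
    · simp [eq_comm]
    · intro j _ hj
      rw [if_neg (by tauto), zero_smul]
    · intro i _ hi
      exact Finset.sum_eq_zero fun j _ => by rw [if_neg (by tauto), zero_smul]
  · rw [Finset.sum_eq_single_of_mem k hk, Finset.sum_eq_single_of_mem l hl]
    · simp
    · intro j _ hj
      rw [if_neg (by tauto), zero_smul]
    · intro i _ hi
      exact Finset.sum_eq_zero fun j _ => by rw [if_neg (by tauto), zero_smul]

/-- The sum of `R̂^{km}_{jl}` against a function of `j` and `k`. -/
theorem sum_Rhat_mixed {W : Type*} [AddCommGroup W] [Module ℂ W] (q : ℝ) (s : Finset ℕ)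
    {m l : ℕ} (hm : m ∈ s) (hl : l ∈ s) (g : ℕ → ℕ → W) :
    ∑ j ∈ s, ∑ k ∈ s, Rhat q k m j l • g j k =
      (q : ℂ) ^ (if l = m then (1 : ℤ) else 0) • g m l +
        (if l = m then (q : ℂ) - (q : ℂ)⁻¹ else 0) • ∑ j ∈ s with j < m, g j j := by
  simp only [Rhat, add_smul, Finset.sum_add_distrib]
  congr 1
  · rw [Finset.sum_eq_single_of_mem m hm, Finset.sum_eq_single_of_mem l hl]
    · simp
    · intro k _ hk
      rw [if_neg (by tauto), zero_smul]
    · intro j _ hj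
      exact Finset.sum_eq_zero fun k _ => by rw [if_neg (by tauto), zero_smul]
  · rw [Finset.sum_filter, Finset.smul_sum]
    refine Finset.sum_congr rfl fun j hj => ?_
    rw [Finset.sum_eq_single_of_mem j hj]
    · by_cases h : l = m <;> by_cases h' : j < m <;> simp [h, h', eq_comm (a := m)]
    · intro k _ hk
      rw [if_neg (by tauto), zero_smul]

/-- The partially contracted quadratic expressions
`Σ_{j,k} q^{2m-2j} R̂^{km}_{jl} z_{xj} z_{ky}`, from which both sides of the
reflection equation are built. -/
def reflTerm (q : ℝ) (N : ℕ) {V : Type*} [Ring V] [Algebra ℂ V] (z : ℕ → ℕ → V)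
    (x l m y : ℕ) : V :=
  ∑ j ∈ Finset.Icc 1 N, ∑ k ∈ Finset.Icc 1 N,
    Rhat q k m j l • (q : ℂ) ^ (2 * (m : ℤ) - 2 * (j : ℤ)) • (z x j * z k y)

theorem reflTerm_eq {q : ℝ} {N : ℕ} {V : Type*} [Ring V] [Algebra ℂ V] (z : ℕ → ℕ → V)
    {l m : ℕ} (x y : ℕ) (hl : l ∈ Finset.Icc 1 N) (hm : m ∈ Finset.Icc 1 N) :
    reflTerm q N z x l m y =
      (q : ℂ) ^ (if l = m then (1 : ℤ) else 0) • (z x m * z l y) +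
        (if l = m then (q : ℂ) - (q : ℂ)⁻¹ else 0) • ∑ j ∈ Finset.Icc 1 N with j < m,
          (q : ℂ) ^ (2 * (m : ℤ) - 2 * (j : ℤ)) • (z x j * z j y) := by
  simp [reflTerm, sum_Rhat_mixed q _ hm hl]

/-- The reflection equation in terms of `reflTerm`. -/
theorem GrassRels.reflTerm_relation {q : ℝ} {N r : ℕ} {V : Type} [Ring V] [Algebra ℂ V]
    {z : ℕ → ℕ → V} (hz : GrassRels q N r z) {a b c d : ℕ}
    (ha : a ∈ Finset.Icc 1 N) (hb : b ∈ Finset.Icc 1 N)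
    (hc : c ∈ Finset.Icc 1 N) (hd : d ∈ Finset.Icc 1 N) :
    (q : ℂ) ^ (if c = d then (1 : ℤ) else 0) • reflTerm q N z d c b a +
        (if c < d then (q : ℂ) - (q : ℂ)⁻¹ else 0) • reflTerm q N z c d b a =
      (q : ℂ) ^ (if a = b then (1 : ℤ) else 0) • reflTerm q N z c d a b +
        (if a < b then (q : ℂ) - (q : ℂ)⁻¹ else 0) • reflTerm q N z c d b a := by
  have h := hz.1 a ha b hb c hc d hd
  rw [← sum_Rhat_upper q _ hc hd (fun i l => reflTerm q N z i l b a),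
    ← sum_Rhat_lower q _ ha hb (fun k l => reflTerm q N z c d l k)]
  convert h using 1
  · refine Finset.sum_congr rfl fun i _ => ?_
    simp only [reflTerm, Finset.smul_sum, smul_smul]
    rw [Finset.sum_comm]
    refine Finset.sum_congr rfl fun j _ => ?_
    rw [Finset.sum_comm]
    refine Finset.sum_congr rfl fun k _ => Finset.sum_congr rfl fun l _ => ?_
    congr 1
    ring
  · simp only [reflTerm, Finset.smul_sum, smul_smul]
    calc _ = ∑ k ∈ Finset.Icc 1 N, ∑ i ∈ Finset.Icc 1 N, ∑ j ∈ Finset.Icc 1 N,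
          ∑ l ∈ Finset.Icc 1 N, (Rhat q a b k l *
            (Rhat q j l i d * (q : ℂ) ^ (2 * (l : ℤ) - 2 * (i : ℤ)))) • (z c i * z j k) := by
          refine Finset.sum_congr rfl fun k _ => ?_
          rw [Finset.sum_comm]
          exact Finset.sum_congr rfl fun i _ => Finset.sum_comm
      _ = _ := by
          rw [Finset.sum_comm]
          refine Finset.sum_congr rfl fun i _ => ?_
          rw [Finset.sum_comm]
          refine Finset.sum_congr rfl fun j _ => Finset.sum_congr rfl fun k _ =>
            Finset.sum_congr rfl fun l _ => ?_
          congr 1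
          ring

/-- The span of the quadratic monomials `z_{ij} z_{kl}` of the same total height
`(j - i) + (l - k)` as `z_{ca} z_{db}` whose first factor has height less than `a - c`. -/
def lowerPairs (N : ℕ) {V : Type*} [Ring V] [Algebra ℂ V] (z : ℕ → ℕ → V) (c a d b : ℕ) :
    Submodule ℂ V :=
  Submodule.span ℂ {x | ∃ i ∈ Finset.Icc 1 N, ∃ j ∈ Finset.Icc 1 N, ∃ k ∈ Finset.Icc 1 N,
    ∃ l ∈ Finset.Icc 1 N, j + c < a + i ∧ j + l + c + d = a + b + i + k ∧ x = z i j * z k l}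

theorem reflTerm_mem_lowerPairs {q : ℝ} {N : ℕ} {V : Type*} [Ring V] [Algebra ℂ V]
    {z : ℕ → ℕ → V} {a b c d x l m y : ℕ} (hx : x ∈ Finset.Icc 1 N) (hl : l ∈ Finset.Icc 1 N)
    (hm : m ∈ Finset.Icc 1 N) (hy : y ∈ Finset.Icc 1 N) (hlt : m + c < a + x)
    (heq : m + y + c + d = a + b + x + l) :
    reflTerm q N z x l m y ∈ lowerPairs N z c a d b := by
  rw [reflTerm_eq z x y hl hm]
  refine add_mem (Submodule.smul_mem _ _ (Submodule.subset_span
    ⟨x, hx, m, hm, l, hl, y, hy, hlt, heq, rfl⟩)) ?_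
  split_ifs with h
  · refine Submodule.smul_mem _ _ (Submodule.sum_mem _ fun j hj => ?_)
    rw [Finset.mem_filter] at hj
    exact Submodule.smul_mem _ _ (Submodule.subset_span
      ⟨x, hx, j, hj.1, j, hj.1, y, hy, by omega, by omega, rfl⟩)
  · simp

/-- A product of two generators in the wrong triangular order can be rewritten in terms of
products whose first factor has smaller height. -/
theorem GrassRels.mul_mem_lowerPairs {q : ℝ} {N r : ℕ} {V : Type} [Ring V] [Algebra ℂ V]
    {z : ℕ → ℕ → V} (hz : GrassRels q N r z) (hq : q ≠ 0) {a b c d : ℕ}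
    (ha : a ∈ Finset.Icc 1 N) (hb : b ∈ Finset.Icc 1 N)
    (hc : c ∈ Finset.Icc 1 N) (hd : d ∈ Finset.Icc 1 N)
    (hca : c ≤ a) (hbd : b ≤ d) (hne : c < a ∨ b < d) :
    z c a * z d b ∈ lowerPairs N z c a d b := by
  have hq' : (q : ℂ) ≠ 0 := by exact_mod_cast hq
  have hrel := hz.reflTerm_relation ha hb hc hd
  have hswap : reflTerm q N z d c b a ∈ lowerPairs N z c a d b :=
    reflTerm_mem_lowerPairs hd hc hb ha (by omega) (by omega)
  have hmain : reflTerm q N z c d a b ∈ lowerPairs N z c a d b := by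
    rcases lt_trichotomy a b with hab | rfl | hab
    · rw [if_pos (show c < d by omega), if_pos hab, if_neg hab.ne, zpow_zero, one_smul,
        add_left_inj] at hrel
      exact hrel ▸ Submodule.smul_mem _ _ hswap
    · rw [if_pos (show c < d by omega), if_neg (lt_irrefl a), if_pos rfl, zpow_one, zero_smul,
        add_zero, if_neg (show c ≠ d by omega), zpow_zero, one_smul, ← eq_sub_iff_add_eq,
        ← sub_smul, sub_sub_cancel] at hrel
      rw [hrel] at hswap
      exact (Submodule.smul_mem_iff _ (inv_ne_zero hq')).1 hswap
    · have hcross : reflTerm q N z c d b a ∈ lowerPairs N z c a d b :=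
        reflTerm_mem_lowerPairs hc hd hb ha (by omega) (by omega)
      rw [if_neg (show ¬ a < b by omega), zero_smul, add_zero, if_neg hab.ne', zpow_zero,
        one_smul] at hrel
      exact hrel ▸ add_mem (Submodule.smul_mem _ _ hswap) (Submodule.smul_mem _ _ hcross)
  rw [reflTerm_eq z c b hd ha] at hmain
  rw [← Submodule.smul_mem_iff _ (zpow_ne_zero (if d = a then (1 : ℤ) else 0) hq')]
  refine (Submodule.add_mem_iff_left _ ?_).1 hmain
  split_ifs with h
  · refine Submodule.smul_mem _ _ (Submodule.sum_mem _ fun j hj => ?_)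
    rw [Finset.mem_filter] at hj
    exact Submodule.smul_mem _ _ (Submodule.subset_span
      ⟨c, hc, j, hj.1, j, hj.1, b, hb, by omega, by omega, rfl⟩)
  · simp

/-- The triangular type of a generator `z_{ij}`: `0`, `1`, `2` according to whether
`i > j`, `i = j` or `i < j`. -/
def triType (x : ℕ × ℕ) : ℕ := if x.2 < x.1 then 0 else if x.1 = x.2 then 1 else 2

/-- The termination measure of a word in the generators: the sum over all nonempty prefixes of
the total (shifted) height `N + j - i` of the prefix. -/
def wordHeight (N : ℕ) : List (ℕ × ℕ) → ℕ
  | [] => 0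
  | x :: w => (N + x.2 - x.1) * (w.length + 1) + wordHeight N w

theorem wordHeight_lt (N : ℕ) (u v : List (ℕ × ℕ)) {a b c d i j k l : ℕ}
    (hc : c ≤ N) (hd : d ≤ N) (hi : i ≤ N)
    (hlt : j + c < a + i) (heq : j + l + c + d = a + b + i + k) :
    wordHeight N (u ++ (i, j) :: (k, l) :: v) < wordHeight N (u ++ (c, a) :: (d, b) :: v) := by
  induction u with
  | nil =>
    simp only [List.nil_append, wordHeight, List.length_cons]
    obtain ⟨t, ht⟩ : ∃ t, N + a - c = N + j - i + t := ⟨N + a - c - (N + j - i), by omega⟩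
    have ht' : N + l - k = N + b - d + t := by omega
    have : 0 < t := by omega
    rw [ht, ht']
    nlinarith
  | cons x u ih =>
    simp only [List.cons_append, wordHeight, List.length_append, List.length_cons]
    omega

theorem exists_adjacent_descent (w : List (ℕ × ℕ))
    (hw : ¬ w.Pairwise (fun x y => triType x ≤ triType y)) :
    ∃ u x y v, w = u ++ x :: y :: v ∧ triType y < triType x := by
  induction w with
  | nil => simp at hw
  | cons x w ih =>
    by_cases h : w.Pairwise (fun x y => triType x ≤ triType y)
    · cases w with
      | nil => simp at hw
      | cons y v =>
        refine ⟨[], x, y, v, rfl, ?_⟩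
        by_contra! hxy
        refine hw (List.pairwise_cons.2 ⟨fun t ht => ?_, h⟩)
        rcases List.mem_cons.1 ht with rfl | ht
        · exact hxy
        · exact hxy.trans ((List.pairwise_cons.1 h).1 t ht)
    · obtain ⟨u, x', y', v, rfl, hlt⟩ := ih h
      exact ⟨x :: u, x', y', v, rfl, hlt⟩

namespace QGrassData

variable {q : ℝ} {N r : ℕ} (G : QGrassData q N r)

/-- The unital subalgebra `V₋` generated by the `z_{ij}` with `i > j`. -/
def lowerAlg : Subalgebra ℂ G.B := Algebra.adjoin ℂ
  {y : G.B | ∃ i ∈ Finset.Icc 1 N, ∃ j ∈ Finset.Icc 1 N, j < i ∧ y = G.z i j}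

/-- The unital subalgebra `V₀` generated by the `z_{ii}`. -/
def diagAlg : Subalgebra ℂ G.B := Algebra.adjoin ℂ
  {y : G.B | ∃ i ∈ Finset.Icc 1 N, y = G.z i i}

/-- The unital subalgebra `V₊` generated by the `z_{ij}` with `i < j`. -/
def upperAlg : Subalgebra ℂ G.B := Algebra.adjoin ℂ
  {y : G.B | ∃ i ∈ Finset.Icc 1 N, ∃ j ∈ Finset.Icc 1 N, i < j ∧ y = G.z i j}

/-- The image of the multiplication map `V₋ ⊗ V₀ ⊗ V₊ → B`. -/
def triSpan : Submodule ℂ G.B := Submodule.span ℂ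
  {x : G.B | ∃ vm ∈ G.lowerAlg, ∃ v0 ∈ G.diagAlg, ∃ vp ∈ G.upperAlg, x = vm * v0 * vp}

/-- The product in `B` of a word in the generators. -/
def wordProd (w : List (ℕ × ℕ)) : G.B := (w.map fun x => G.z x.1 x.2).prod

theorem wordProd_append (u v : List (ℕ × ℕ)) :
    G.wordProd (u ++ v) = G.wordProd u * G.wordProd v := by
  simp [wordProd]

theorem wordProd_cons (x : ℕ × ℕ) (v : List (ℕ × ℕ)) :
    G.wordProd (x :: v) = G.z x.1 x.2 * G.wordProd v := by
  simp [wordProd]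

theorem wordProd_mem_upperAlg (w : List (ℕ × ℕ))
    (hw : ∀ x ∈ w, x.1 ∈ Finset.Icc 1 N ∧ x.2 ∈ Finset.Icc 1 N) (ht : ∀ x ∈ w, 2 ≤ triType x) :
    G.wordProd w ∈ G.upperAlg := by
  refine Subalgebra.list_prod_mem _ fun y hy => ?_
  obtain ⟨x, hx, rfl⟩ := List.mem_map.1 hy
  have := ht x hx
  refine Algebra.subset_adjoin ⟨x.1, (hw x hx).1, x.2, (hw x hx).2, ?_, rfl⟩
  unfold triType at this
  split_ifs at this <;> omega

theorem wordProd_eq_diag_mul_upper (w : List (ℕ × ℕ))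
    (hw : ∀ x ∈ w, x.1 ∈ Finset.Icc 1 N ∧ x.2 ∈ Finset.Icc 1 N) (ht : ∀ x ∈ w, 1 ≤ triType x)
    (hs : w.Pairwise (fun x y => triType x ≤ triType y)) :
    ∃ v0 ∈ G.diagAlg, ∃ vp ∈ G.upperAlg, G.wordProd w = v0 * vp := by
  induction w with
  | nil => exact ⟨1, one_mem _, 1, one_mem _, by simp [wordProd]⟩
  | cons x w ih =>
    rw [List.pairwise_cons] at hs
    by_cases hx : 2 ≤ triType x
    · refine ⟨1, one_mem _, _, G.wordProd_mem_upperAlg _ hw fun y hy => ?_, (one_mul _).symm⟩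
      rcases List.mem_cons.1 hy with rfl | hy
      · exact hx
      · exact hx.trans (hs.1 y hy)
    · obtain ⟨v0, h0, vp, hp, h⟩ := ih (fun y hy => hw y (List.mem_cons_of_mem _ hy))
        (fun y hy => ht y (List.mem_cons_of_mem _ hy)) hs.2
      refine ⟨G.z x.1 x.2 * v0, mul_mem (Algebra.subset_adjoin ?_) h0, vp, hp, ?_⟩
      · have h1 := ht x List.mem_cons_self
        have hdiag : x.1 = x.2 := by
          unfold triType at h1 hx
          split_ifs at h1 hx <;> omega
        exact ⟨x.1, (hw x List.mem_cons_self).1, by rw [← hdiag]⟩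
      · rw [wordProd_cons, h, mul_assoc]

theorem wordProd_mem_triSpan_of_pairwise (w : List (ℕ × ℕ))
    (hw : ∀ x ∈ w, x.1 ∈ Finset.Icc 1 N ∧ x.2 ∈ Finset.Icc 1 N)
    (hs : w.Pairwise (fun x y => triType x ≤ triType y)) :
    G.wordProd w ∈ G.triSpan := by
  suffices ∃ vm ∈ G.lowerAlg, ∃ v0 ∈ G.diagAlg, ∃ vp ∈ G.upperAlg,
      G.wordProd w = vm * v0 * vp from Submodule.subset_span this
  induction w with
  | nil => exact ⟨1, one_mem _, 1, one_mem _, 1, one_mem _, by simp [wordProd]⟩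
  | cons x w ih =>
    by_cases hx : 1 ≤ triType x
    · have ht : ∀ y ∈ x :: w, 1 ≤ triType y := fun y hy => by
        rcases List.mem_cons.1 hy with rfl | hy
        · exact hx
        · exact hx.trans ((List.pairwise_cons.1 hs).1 y hy)
      obtain ⟨v0, h0, vp, hp, h⟩ := G.wordProd_eq_diag_mul_upper _ hw ht hs
      exact ⟨1, one_mem _, v0, h0, vp, hp, by rw [h, one_mul]⟩
    · obtain ⟨vm, hm, v0, h0, vp, hp, h⟩ := ih (fun y hy => hw y (List.mem_cons_of_mem _ hy))
        (List.pairwise_cons.1 hs).2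
      obtain ⟨h1, h2⟩ := hw x List.mem_cons_self
      refine ⟨G.z x.1 x.2 * vm, mul_mem (Algebra.subset_adjoin ⟨x.1, h1, x.2, h2, ?_, rfl⟩) hm,
        v0, h0, vp, hp, ?_⟩
      · unfold triType at hx
        split_ifs at hx <;> omega
      · rw [wordProd_cons, h]
        simp only [mul_assoc]

theorem wordProd_mem_triSpan (hq : q ≠ 0) (w : List (ℕ × ℕ))
    (hw : ∀ x ∈ w, x.1 ∈ Finset.Icc 1 N ∧ x.2 ∈ Finset.Icc 1 N) :
    G.wordProd w ∈ G.triSpan := by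
  induction hn : wordHeight N w using Nat.strong_induction_on generalizing w with
  | _ n ih =>
  by_cases hs : w.Pairwise (fun x y => triType x ≤ triType y)
  · exact G.wordProd_mem_triSpan_of_pairwise w hw hs
  obtain ⟨u, ⟨c, a⟩, ⟨d, b⟩, v, rfl, hlt⟩ := exists_adjacent_descent w hs
  obtain ⟨hc, ha⟩ := hw (c, a) (by simp)
  obtain ⟨hd, hb⟩ := hw (d, b) (by simp)
  have hbad : c ≤ a ∧ b ≤ d ∧ (c < a ∨ b < d) := by
    unfold triType at hlt
    split_ifs at hlt <;> dsimp only at * <;> omega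
  have hmem := G.rels.mul_mem_lowerPairs hq ha hb hc hd hbad.1 hbad.2.1 hbad.2.2
  have hsub : lowerPairs N G.z c a d b ≤ G.triSpan.comap
      ((LinearMap.mulRight ℂ (G.wordProd v)).comp (LinearMap.mulLeft ℂ (G.wordProd u))) := by
    refine Submodule.span_le.2 ?_
    rintro _ ⟨i, hi, j, hj, k, hk, l, hl, hlt', heq, rfl⟩
    have hprod := ih _ (hn ▸ wordHeight_lt N u v (Finset.mem_Icc.1 hc).2 (Finset.mem_Icc.1 hd).2
      (Finset.mem_Icc.1 hi).2 hlt' heq)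
      (u ++ (i, j) :: (k, l) :: v) ?_ rfl
    · simpa [wordProd_append, wordProd_cons, mul_assoc] using hprod
    · intro x hx
      simp only [List.mem_append, List.mem_cons] at hx
      rcases hx with hx | rfl | rfl | hx
      · exact hw x (by simp [hx])
      · exact ⟨hi, hj⟩
      · exact ⟨hk, hl⟩
      · exact hw x (by simp [hx])
  simpa [wordProd_append, wordProd_cons, mul_assoc] using hsub hmem

theorem triSpan_eq_top (hq : q ≠ 0) : G.triSpan = ⊤ := by
  rw [eq_top_iff, ← Algebra.top_toSubmodule, ← G.gen, Algebra.adjoin_eq_span, Submodule.span_le]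
  intro x hx
  obtain ⟨l, hl, rfl⟩ := Submonoid.exists_list_of_mem_closure hx
  obtain ⟨w, hw, rfl⟩ : ∃ w : List (ℕ × ℕ),
      (∀ x ∈ w, x.1 ∈ Finset.Icc 1 N ∧ x.2 ∈ Finset.Icc 1 N) ∧
        w.map (fun x => G.z x.1 x.2) = l := by
    clear hx
    induction l with
    | nil => exact ⟨[], by simp, rfl⟩
    | cons y l ih =>
      obtain ⟨w, hw, rfl⟩ := ih fun t ht => hl t (List.mem_cons_of_mem _ ht)
      obtain ⟨i, hi, j, hj, rfl⟩ := hl y List.mem_cons_self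
      exact ⟨(i, j) :: w, List.forall_mem_cons.2 ⟨⟨hi, hj⟩, hw⟩, rfl⟩
  exact G.wordProd_mem_triSpan hq w hw

end QGrassData


/-- Lemma `onto`.  The multiplication map
`V₋ ⊗ V₀ ⊗ V₊ → B` is surjective: every element of `B = O_q(Gr(r,N))` is a linear
combination of monomials `v₋ v₀ v₊`, where `v₋`, `v₀`, `v₊` lie in the (unital)
subalgebras generated by the `z_{ij}` with `i > j`, `i = j` and `i < j` respectively. -/
theorem triangular_multiplication_surjective
    (q : ℝ) (hq₁ : q ≠ -1) (hq₂ : q ≠ 0) (hq₃ : q ≠ 1)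
    (N r : ℕ) (hN : 2 ≤ N) (hr1 : 1 ≤ r) (hr2 : r ≤ N - 1)
    (G : QGrassData q N r) :
    Submodule.span ℂ
        {x : G.B |
          ∃ vm ∈ Algebra.adjoin ℂ
              {y : G.B | ∃ i ∈ Finset.Icc 1 N, ∃ j ∈ Finset.Icc 1 N, j < i ∧ y = G.z i j},
          ∃ v0 ∈ Algebra.adjoin ℂ
              {y : G.B | ∃ i ∈ Finset.Icc 1 N, y = G.z i i},
          ∃ vp ∈ Algebra.adjoin ℂ
              {y : G.B | ∃ i ∈ Finset.Icc 1 N, ∃ j ∈ Finset.Icc 1 N, i < j ∧ y = G.z i j},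
          x = vm * v0 * vp} = ⊤ := by
  exact G.triSpan_eq_top hq₂
end
end

section
/- Let T be the quantum tangent space of a covariant first order differential calculus over B, let {t_i} be a basis of T^ε = T ⊕ ℂε, let a_ij ∈ B° be defined by Δ(t_i) = Σ_j a_ij ⊗ t_j, and let T' ⊆ B° be the subcoalgebra generated by the a_ij. If K' ⊂ U_q(sl_N) denotes the commutative subalgebra generated by K₁,…,K_{N−1}, then T'·K' ⊆ T'. -/
noncomputable section

open scoped TensorProduct

/-- Cartan integers of `sl_N`. -/
def cartanSL (i j : ℕ) : ℤ :=
  if i = j then 2 else if ((i : ℤ) - j).natAbs = 1 then -1 else 0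

/-- The defining relations of `U_q(sl_N)` for a candidate family of generators. -/
def UqslRels (q : ℝ) (N : ℕ) {V : Type} [Ring V] [Algebra ℂ V]
    (e f kg ki : ℕ → V) : Prop :=
  (∀ i ∈ Finset.Icc 1 (N - 1), kg i * ki i = 1 ∧ ki i * kg i = 1) ∧
  (∀ i ∈ Finset.Icc 1 (N - 1), ∀ j ∈ Finset.Icc 1 (N - 1),
      kg i * kg j = kg j * kg i) ∧
  (∀ i ∈ Finset.Icc 1 (N - 1), ∀ j ∈ Finset.Icc 1 (N - 1),
      kg i * e j = ((q : ℂ) ^ (cartanSL i j)) • (e j * kg i)) ∧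
  (∀ i ∈ Finset.Icc 1 (N - 1), ∀ j ∈ Finset.Icc 1 (N - 1),
      kg i * f j = ((q : ℂ) ^ (-cartanSL i j)) • (f j * kg i)) ∧
  (∀ i ∈ Finset.Icc 1 (N - 1), ∀ j ∈ Finset.Icc 1 (N - 1),
      e i * f j - f j * e i =
        if i = j then (((q : ℂ) - (q : ℂ)⁻¹)⁻¹) • (kg i - ki i) else 0) ∧
  (∀ i ∈ Finset.Icc 1 (N - 1), ∀ j ∈ Finset.Icc 1 (N - 1), ((i : ℤ) - j).natAbs = 1 →
      e i * e i * e j - ((q : ℂ) + (q : ℂ)⁻¹) • (e i * e j * e i) + e j * e i * e i = 0) ∧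
  (∀ i ∈ Finset.Icc 1 (N - 1), ∀ j ∈ Finset.Icc 1 (N - 1), 2 ≤ ((i : ℤ) - j).natAbs →
      e i * e j = e j * e i) ∧
  (∀ i ∈ Finset.Icc 1 (N - 1), ∀ j ∈ Finset.Icc 1 (N - 1), ((i : ℤ) - j).natAbs = 1 →
      f i * f i * f j - ((q : ℂ) + (q : ℂ)⁻¹) • (f i * f j * f i) + f j * f i * f i = 0) ∧
  (∀ i ∈ Finset.Icc 1 (N - 1), ∀ j ∈ Finset.Icc 1 (N - 1), 2 ≤ ((i : ℤ) - j).natAbs →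
      f i * f j = f j * f i)

/-- The quantized enveloping algebra `U_q(sl_N)` together with its Hopf algebra
structure, generators, defining relations and universal property. -/
structure UqslData (q : ℝ) (N : ℕ) where
  U : Type
  [instRing : Ring U]
  [instHopf : HopfAlgebra ℂ U]
  E : ℕ → U
  F : ℕ → U
  Kg : ℕ → U
  Ki : ℕ → U
  rels : UqslRels q N E F Kg Ki
  comul_E : ∀ i ∈ Finset.Icc 1 (N - 1),
    Coalgebra.comul (R := ℂ) (E i) = E i ⊗ₜ[ℂ] 1 + Kg i ⊗ₜ[ℂ] E i
  comul_F : ∀ i ∈ Finset.Icc 1 (N - 1),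
    Coalgebra.comul (R := ℂ) (F i) = F i ⊗ₜ[ℂ] Ki i + 1 ⊗ₜ[ℂ] F i
  comul_Kg : ∀ i ∈ Finset.Icc 1 (N - 1),
    Coalgebra.comul (R := ℂ) (Kg i) = Kg i ⊗ₜ[ℂ] Kg i
  comul_Ki : ∀ i ∈ Finset.Icc 1 (N - 1),
    Coalgebra.comul (R := ℂ) (Ki i) = Ki i ⊗ₜ[ℂ] Ki i
  counit_E : ∀ i ∈ Finset.Icc 1 (N - 1), Coalgebra.counit (R := ℂ) (E i) = 0
  counit_F : ∀ i ∈ Finset.Icc 1 (N - 1), Coalgebra.counit (R := ℂ) (F i) = 0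
  counit_Kg : ∀ i ∈ Finset.Icc 1 (N - 1), Coalgebra.counit (R := ℂ) (Kg i) = 1
  counit_Ki : ∀ i ∈ Finset.Icc 1 (N - 1), Coalgebra.counit (R := ℂ) (Ki i) = 1
  gen : Algebra.adjoin ℂ
      {x : U | ∃ i ∈ Finset.Icc 1 (N - 1), x = E i ∨ x = F i ∨ x = Kg i ∨ x = Ki i} = ⊤
  univ : ∀ (V : Type) [Ring V] [Algebra ℂ V] (e f kg ki : ℕ → V),
      UqslRels q N e f kg ki → ∃ φ : U →ₐ[ℂ] V,
        ∀ i ∈ Finset.Icc 1 (N - 1),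
          φ (E i) = e i ∧ φ (F i) = f i ∧ φ (Kg i) = kg i ∧ φ (Ki i) = ki i

attribute [instance] UqslData.instRing UqslData.instHopf

namespace UqslData

variable {q : ℝ} {N : ℕ} (D : UqslData q N)

/-- Root vectors `E_{α_{i,i+d}}` (iterated `q`-commutators with respect to the
standard reduced decomposition of the longest Weyl group element). -/
def Ev : ℕ → ℕ → D.U
  | 0, i => D.E i
  | d + 1, i => D.E i * Ev d (i + 1) - (q : ℂ)⁻¹ • (Ev d (i + 1) * D.E i)

/-- Root vectors `F_{α_{i,i+d}}`. -/
def Fv : ℕ → ℕ → D.U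
  | 0, i => D.F i
  | d + 1, i => Fv d (i + 1) * D.F i - (q : ℂ)⁻¹ • (D.F i * Fv d (i + 1))

/-- The Hopf subalgebra `K` generated by `E_i, F_i (i ≠ r)` and all `K_j^{±1}`. -/
def Ksub (r : ℕ) : Subalgebra ℂ D.U :=
  Algebra.adjoin ℂ
    ({x : D.U | ∃ i ∈ Finset.Icc 1 (N - 1), i ≠ r ∧ (x = D.E i ∨ x = D.F i)} ∪
     {x : D.U | ∃ j ∈ Finset.Icc 1 (N - 1), x = D.Kg j ∨ x = D.Ki j})

/-- The subspace `K⁺U ⊆ U`. -/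
def Jsub (r : ℕ) : Submodule ℂ D.U :=
  Submodule.span ℂ
    {x : D.U | ∃ k ∈ D.Ksub r, Coalgebra.counit (R := ℂ) k = 0 ∧ ∃ u : D.U, x = k * u}

/-- The subspace `K⁺U ⊗ U + U ⊗ K⁺U` of `U ⊗ U`, i.e. the kernel of `π ⊗ π` where
`π : U → U/K⁺U` is the canonical projection. -/
def JUU (r : ℕ) : Submodule ℂ (D.U ⊗[ℂ] D.U) :=
  LinearMap.range (TensorProduct.map (D.Jsub r).subtype LinearMap.id) ⊔
  LinearMap.range (TensorProduct.map LinearMap.id (D.Jsub r).subtype)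

/-- `x ∈ U` represents a primitive element of the quotient coalgebra `Ū = U/K⁺U`. -/
def IsPrimitiveMod (r : ℕ) (x : D.U) : Prop :=
  Coalgebra.comul (R := ℂ) x - x ⊗ₜ[ℂ] 1 - 1 ⊗ₜ[ℂ] x ∈ D.JUU r

end UqslData

/-- Membership of the pair `(i,j)` in (the index set of) `Φ⁺_r`, the set of positive
roots `α_{ij} = α_i + ⋯ + α_j` of `sl_N` with `i ≤ r ≤ j`. -/
def inPhiR (N r : ℕ) (p : ℕ × ℕ) : Prop :=
  1 ≤ p.1 ∧ p.1 ≤ r ∧ r ≤ p.2 ∧ p.2 ≤ N - 1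



/-- The quantized function algebra `A = O_q(SL_N)` together with the nondegenerate Hopf
pairing with `U = U_q(sl_N)`:  `A` is a Hopf algebra generated by the matrix coefficients
`u^i_j` of the fundamental corepresentation, and the pairing is fixed by its values on
the generators (the fundamental representation of `U_q(sl_N)`). -/
structure QslnFun (q : ℝ) (N : ℕ) (D : UqslData q N) where
  A : Type
  [instRingA : Ring A]
  [instHopfA : HopfAlgebra ℂ A]
  u : ℕ → ℕ → A
  genA : Algebra.adjoin ℂ
      {x : A | ∃ i ∈ Finset.Icc 1 N, ∃ j ∈ Finset.Icc 1 N, x = u i j} = ⊤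
  comul_u : ∀ i ∈ Finset.Icc 1 N, ∀ j ∈ Finset.Icc 1 N,
    Coalgebra.comul (R := ℂ) (u i j) = ∑ k ∈ Finset.Icc 1 N, u i k ⊗ₜ[ℂ] u k j
  counit_u : ∀ i ∈ Finset.Icc 1 N, ∀ j ∈ Finset.Icc 1 N,
    Coalgebra.counit (R := ℂ) (u i j) = if i = j then 1 else 0
  pair : D.U →ₗ[ℂ] A →ₗ[ℂ] ℂ
  pair_mulU : ∀ (x y : D.U) (a : A), pair (x * y) a =
    LinearMap.mul' ℂ ℂ (TensorProduct.map (pair x) (pair y) (Coalgebra.comul (R := ℂ) a))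
  pair_mulA : ∀ (x : D.U) (a b : A), pair x (a * b) =
    LinearMap.mul' ℂ ℂ (TensorProduct.map (pair.flip a) (pair.flip b)
      (Coalgebra.comul (R := ℂ) x))
  pair_oneU : ∀ a : A, pair 1 a = Coalgebra.counit (R := ℂ) a
  pair_oneA : ∀ x : D.U, pair x 1 = Coalgebra.counit (R := ℂ) x
  pair_antipode : ∀ (x : D.U) (a : A),
    pair (HopfAlgebra.antipode (R := ℂ) x) a = pair x (HopfAlgebra.antipode (R := ℂ) a)
  pair_E : ∀ l ∈ Finset.Icc 1 (N - 1), ∀ i ∈ Finset.Icc 1 N, ∀ j ∈ Finset.Icc 1 N,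
    pair (D.E l) (u i j) = if i = l ∧ j = l + 1 then 1 else 0
  pair_F : ∀ l ∈ Finset.Icc 1 (N - 1), ∀ i ∈ Finset.Icc 1 N, ∀ j ∈ Finset.Icc 1 N,
    pair (D.F l) (u i j) = if i = l + 1 ∧ j = l then 1 else 0
  pair_Kg : ∀ l ∈ Finset.Icc 1 (N - 1), ∀ i ∈ Finset.Icc 1 N, ∀ j ∈ Finset.Icc 1 N,
    pair (D.Kg l) (u i j) =
      if i = j then (if i = l then (q : ℂ) else if i = l + 1 then (q : ℂ)⁻¹ else 1) else 0
  pair_Ki : ∀ l ∈ Finset.Icc 1 (N - 1), ∀ i ∈ Finset.Icc 1 N, ∀ j ∈ Finset.Icc 1 N,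
    pair (D.Ki l) (u i j) =
      if i = j then (if i = l then (q : ℂ)⁻¹ else if i = l + 1 then (q : ℂ) else 1) else 0
  nondegU : ∀ x : D.U, (∀ a : A, pair x a = 0) → x = 0
  nondegA : ∀ a : A, (∀ x : D.U, pair x a = 0) → a = 0

attribute [instance] QslnFun.instRingA QslnFun.instHopfA

namespace QslnFun

variable {q : ℝ} {N : ℕ} {D : UqslData q N} (P : QslnFun q N D)

/-- For `k : U`, the operator `a ↦ ⟨k, a₍₁₎⟩ a₍₂₎` on `A`. -/
def hitL (k : D.U) : P.A →ₗ[ℂ] P.A :=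
  TensorProduct.lift ((LinearMap.lsmul ℂ P.A).comp (P.pair k)) ∘ₗ
    Coalgebra.comul (R := ℂ)

/-- The quantum Grassmannian `B = O_q(Gr(r,N))` inside `A`, as the subspace
`{b ∈ A | ⟨k, b₍₁₎⟩ b₍₂₎ = 0 for all k ∈ K⁺}`. -/
def Bmod (r : ℕ) : Submodule ℂ P.A :=
  ⨅ k : ↥(D.Ksub r),
    LinearMap.ker (P.hitL ((k : D.U) - algebraMap ℂ D.U
      (Coalgebra.counit (R := ℂ) (k : D.U))))

end QslnFun



section DualDefs

variable {U A : Type} [Ring U] [HopfAlgebra ℂ U] [Ring A] [HopfAlgebra ℂ A]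

/-- The subspace `A·B⁺ ⊆ A`. -/
def ABp (Bsub : Subalgebra ℂ A) : Submodule ℂ A :=
  Submodule.span ℂ
    {x : A | ∃ a : A, ∃ b ∈ Bsub, Coalgebra.counit (R := ℂ) b = 0 ∧ x = a * b}

/-- The map `Δ̄ : B → A ⊗ Ā`, where `Ā = A/AB⁺`. -/
def DbarB (Bsub : Subalgebra ℂ A) :
    ↥Bsub →ₗ[ℂ] A ⊗[ℂ] (A ⧸ ABp Bsub) :=
  (TensorProduct.map LinearMap.id (ABp Bsub).mkQ) ∘ₗ (Coalgebra.comul (R := ℂ)) ∘ₗ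
    Bsub.val.toLinearMap

/-- The counit of `A` restricted to the subalgebra `B`. -/
def counitB (Bsub : Subalgebra ℂ A) : Module.Dual ℂ ↥Bsub :=
  (Coalgebra.counit (R := ℂ) (A := A)) ∘ₗ Bsub.val.toLinearMap

/-- The augmentation ideal `B⁺ = B ∩ ker ε` of `B`. -/
def BplusB (Bsub : Subalgebra ℂ A) : Submodule ℂ ↥Bsub :=
  LinearMap.ker (counitB Bsub)

/-- `Δ̄(I) ⊆ I ⊗ Ā`. -/
def DbarStable (Bsub : Subalgebra ℂ A) (I : Submodule ℂ ↥Bsub) : Prop :=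
  ∀ x ∈ I, DbarB Bsub x ∈
    LinearMap.range (TensorProduct.map (Bsub.val.toLinearMap ∘ₗ I.subtype)
      (LinearMap.id (R := ℂ) (M := A ⧸ ABp Bsub)))

/-- The data of a covariant first order differential calculus over `B`, in the form of
the associated left ideal: `I ⊆ B⁺`, `B·I ⊆ I` and `Δ̄(I) ⊆ I ⊗ Ā`. -/
def FODCIdeal (Bsub : Subalgebra ℂ A) (I : Submodule ℂ ↥Bsub) : Prop :=
  I ≤ BplusB Bsub ∧ (∀ b : ↥Bsub, ∀ x ∈ I, b * x ∈ I) ∧ DbarStable Bsub I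

/-- The quantum tangent space `T(Γ) = {f ∈ B' | f(1) = 0, f(I) = 0}` of the covariant
calculus corresponding to the ideal `I`. -/
def TanOfIdeal (Bsub : Subalgebra ℂ A) (I : Submodule ℂ ↥Bsub) :
    Submodule ℂ (Module.Dual ℂ ↥Bsub) :=
  (⨅ x : ↥I, LinearMap.ker (Module.Dual.eval ℂ ↥Bsub ((x : ↥I) : ↥Bsub))) ⊓
    LinearMap.ker (Module.Dual.eval ℂ ↥Bsub (1 : ↥Bsub))

/-- `g` is the result of the right action of `k ∈ U` on the functional `f ∈ B'`:
`g(b) = f(b₍₀₎) ⟨k, b₍₁₎⟩` where `Δ(b) = b₍₀₎ ⊗ b₍₁₎ ∈ B ⊗ A`. -/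
def IsDualAct (pair : U →ₗ[ℂ] A →ₗ[ℂ] ℂ) (Bsub : Subalgebra ℂ A)
    (f : Module.Dual ℂ ↥Bsub) (k : U) (g : Module.Dual ℂ ↥Bsub) : Prop :=
  ∀ (b : ↥Bsub) (c : ↥Bsub ⊗[ℂ] A),
    TensorProduct.map Bsub.val.toLinearMap LinearMap.id c =
      Coalgebra.comul (R := ℂ) (b : A) →
    g b = TensorProduct.lift (((LinearMap.mul ℂ ℂ) ∘ₗ f).compl₂ (pair k)) c

end DualDefs

section MatrixCoefficients

variable {k B : Type*} [Field k] [Ring B] [Algebra k B]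

/-- If a family of functionals has matrix coefficients `a i j` and its span is stable under
composition with an automorphism and with its inverse, then so is the span of the `a i j`. -/
theorem matrixCoeff_comp_mem_span {n : ℕ} {t : Fin n → Module.Dual k B}
    (htind : LinearIndependent k t) {a : Fin n → Fin n → Module.Dual k B}
    (ha : ∀ (i : Fin n) (b c : B), t i (b * c) = ∑ j, a i j b * t j c)
    (κ κ' : B →ₗ[k] B) (hmul : ∀ b c, κ (b * c) = κ b * κ c)
    (hinv : ∀ b, κ (κ' b) = b)
    (hκ : ∀ i, t i ∘ₗ κ ∈ Submodule.span k (Set.range t))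
    (hκ' : ∀ i, t i ∘ₗ κ' ∈ Submodule.span k (Set.range t)) (i l : Fin n) :
    a i l ∘ₗ κ ∈ Submodule.span k {g : Module.Dual k B | ∃ i j, g = a i j} := by
  simp only [Submodule.mem_span_range_iff_exists_fun] at hκ hκ'
  choose M hM using hκ
  choose M' hM' using hκ'
  have hM (i : Fin n) (b : B) : t i (κ b) = ∑ j, M i j * t j b := by
    simpa using (LinearMap.congr_fun (hM i) b).symm
  have hM' (i : Fin n) (b : B) : t i (κ' b) = ∑ j, M' i j * t j b := by
    simpa using (LinearMap.congr_fun (hM' i) b).symm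
  have key : a i l ∘ₗ κ = ∑ j, ∑ m, (M i j * M' m l) • a j m := by
    ext b
    have hsum : ∑ l, (a i l (κ b) - ∑ j, ∑ m, M i j * M' m l * a j m b) • t l = 0 := by
      ext c
      have h : t i (κ b * c) = ∑ j, M i j * ∑ m, a j m b * ∑ l, M' m l * t l c := by
        conv_lhs => rw [← hinv c, ← hmul, hM]
        simp only [ha, hM']
      rw [ha] at h
      simp only [LinearMap.sum_apply, LinearMap.smul_apply, smul_eq_mul, sub_mul,
        Finset.sum_sub_distrib, LinearMap.zero_apply, h, sub_eq_zero, Finset.mul_sum,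
        Finset.sum_mul]
      conv_rhs => rw [Finset.sum_comm]
      refine Finset.sum_congr rfl fun j _ => ?_
      rw [Finset.sum_comm]
      exact Finset.sum_congr rfl fun l _ => Finset.sum_congr rfl fun m _ => by ring
    have h0 := Fintype.linearIndependent_iff.mp htind _ hsum l
    simpa [sub_eq_zero] using h0
  rw [key]
  exact Submodule.sum_mem _ fun j _ => Submodule.sum_mem _ fun m _ =>
    Submodule.smul_mem _ _ (Submodule.subset_span ⟨j, m, rfl⟩)

end MatrixCoefficients

section Slices

variable {k V W : Type*} [Field k] [AddCommGroup V] [Module k V] [AddCommGroup W] [Module k W]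

/-- The slice map `v ⊗ w ↦ φ(w) v`. -/
def sliceR (V : Type*) [AddCommGroup V] [Module k V] (φ : Module.Dual k W) : V ⊗[k] W →ₗ[k] V :=
  (TensorProduct.rid k V).toLinearMap ∘ₗ TensorProduct.map LinearMap.id φ

@[simp] theorem sliceR_tmul (φ : Module.Dual k W) (v : V) (w : W) :
    sliceR V φ (v ⊗ₜ w) = φ w • v := by
  simp [sliceR]

/-- A tensor all of whose slices lie in the range of `f` lies in the range of `f ⊗ id`. -/
theorem mem_range_map_of_sliceR_mem {V' : Type*} [AddCommGroup V'] [Module k V']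
    (f : V' →ₗ[k] V) (x : V ⊗[k] W)
    (hx : ∀ φ : Module.Dual k W, sliceR V φ x ∈ LinearMap.range f) :
    x ∈ LinearMap.range (TensorProduct.map f (LinearMap.id (R := k) (M := W))) := by
  let b := Module.Basis.ofVectorSpace k W
  obtain ⟨c, rfl⟩ := TensorProduct.eq_repr_basis_right b x
  refine Submodule.sum_mem _ fun i hi => ?_
  have h := hx (b.coord i)
  have : sliceR V (b.coord i) (c.sum fun i m => m ⊗ₜ[k] b i) = c i := by
    classical
    simp [Finsupp.sum, map_sum, Finsupp.single_apply, ite_smul]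
    tauto
  rw [this] at h
  obtain ⟨v, hv⟩ := h
  exact ⟨v ⊗ₜ b i, by simp [hv]⟩

end Slices

section RightTranslation

variable {A : Type} [Ring A] [HopfAlgebra ℂ A]

/-- The right translation `a ↦ a₍₁₎ φ(a₍₂₎)`. -/
def transR (φ : Module.Dual ℂ A) : A →ₗ[ℂ] A :=
  sliceR A φ ∘ₗ Coalgebra.comul (R := ℂ)

theorem transR_transR (φ ψ : Module.Dual ℂ A) (a : A) :
    transR φ (transR ψ a) = transR (φ ∘ₗ transR ψ) a := by
  have h := Coalgebra.coassoc_apply (R := ℂ) a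
  have h1 : transR φ ∘ₗ sliceR A ψ = sliceR A φ ∘ₗ sliceR (A ⊗[ℂ] A) ψ ∘ₗ
      TensorProduct.map (Coalgebra.comul (R := ℂ)) LinearMap.id := by
    ext x y
    simp [transR]
  have h2 : sliceR A (φ ∘ₗ transR ψ) = sliceR A φ ∘ₗ sliceR (A ⊗[ℂ] A) ψ ∘ₗ
      (TensorProduct.assoc ℂ A A A).symm.toLinearMap ∘ₗ
      TensorProduct.map LinearMap.id (Coalgebra.comul (R := ℂ)) := by
    have h3 : sliceR A φ ∘ₗ sliceR (A ⊗[ℂ] A) ψ ∘ₗ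
        (TensorProduct.assoc ℂ A A A).symm.toLinearMap =
        sliceR A φ ∘ₗ TensorProduct.map LinearMap.id (sliceR A ψ) := by
      ext x y z
      simp
    ext x y
    have := LinearMap.congr_fun h3 (x ⊗ₜ Coalgebra.comul (R := ℂ) y)
    simp only [LinearMap.comp_apply, TensorProduct.map_tmul, LinearMap.id_apply,
      LinearEquiv.coe_coe] at this
    simp [transR, this]
  calc transR φ (transR ψ a) = (transR φ ∘ₗ sliceR A ψ) (Coalgebra.comul (R := ℂ) a) := rfl
    _ = sliceR A (φ ∘ₗ transR ψ) (Coalgebra.comul (R := ℂ) a) := by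
      rw [h1, h2]
      have h' := congrArg (TensorProduct.assoc ℂ A A A).symm h
      rw [LinearEquiv.symm_apply_apply] at h'
      exact congrArg (fun z => sliceR A φ (sliceR (A ⊗[ℂ] A) ψ z)) h'

theorem transR_counit (a : A) : transR (Coalgebra.counit (R := ℂ)) a = a := by
  have h := Coalgebra.lTensor_counit_comul (R := ℂ) a
  have := congrArg (TensorProduct.rid ℂ A) h
  simpa [transR, sliceR, LinearMap.lTensor] using this

theorem counit_transR (φ : Module.Dual ℂ A) (a : A) :
    Coalgebra.counit (R := ℂ) (transR φ a) = φ a := by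
  have h := Coalgebra.rTensor_counit_comul (R := ℂ) a
  have h1 : (Coalgebra.counit (R := ℂ)) ∘ₗ sliceR A φ = φ ∘ₗ
      (TensorProduct.lid ℂ A).toLinearMap ∘ₗ (Coalgebra.counit (R := ℂ)).rTensor A := by
    ext x y
    simp [mul_comm]
  have := LinearMap.congr_fun h1 (Coalgebra.comul (R := ℂ) a)
  simpa [transR, h] using this

theorem transR_mul {φ : Module.Dual ℂ A} (hφ : ∀ a b, φ (a * b) = φ a * φ b) (a b : A) :
    transR φ (a * b) = transR φ a * transR φ b := by
  have h (x y : A ⊗[ℂ] A) : sliceR A φ (x * y) = sliceR A φ x * sliceR A φ y := by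
    induction x with
    | zero => simp
    | add x x' hx hx' => simp [add_mul, hx, hx']
    | tmul x x' =>
      induction y with
      | zero => simp
      | add y y' hy hy' => simp [mul_add, hy, hy']
      | tmul y y' => simp [hφ, mul_smul, smul_comm (φ x')]
  simp [transR, h]

theorem transR_one {φ : Module.Dual ℂ A} (hφ : φ 1 = 1) : transR φ 1 = 1 := by
  simp [transR, Algebra.TensorProduct.one_def, hφ]

theorem transR_mem_of_DbarStable {Bsub : Subalgebra ℂ A} {I : Submodule ℂ ↥Bsub}
    (hI : DbarStable Bsub I) {φ : Module.Dual ℂ A} (hφ : ∀ a ∈ ABp Bsub, φ a = 0)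
    {x : ↥Bsub} (hx : x ∈ I) : ∃ y ∈ I, (y : A) = transR φ x := by
  obtain ⟨w, hw⟩ := hI x hx
  let ψ : Module.Dual ℂ (A ⧸ ABp Bsub) := (ABp Bsub).liftQ φ hφ
  refine ⟨sliceR I ψ w, (sliceR I ψ w).2, ?_⟩
  have h1 : sliceR A ψ ∘ₗ TensorProduct.map (Bsub.val.toLinearMap ∘ₗ I.subtype)
      LinearMap.id = (Bsub.val.toLinearMap ∘ₗ I.subtype) ∘ₗ sliceR I ψ := by
    ext u v
    simp
  have h2 : sliceR A ψ ∘ₗ TensorProduct.map LinearMap.id (ABp Bsub).mkQ = sliceR A φ := by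
    ext u v
    exact sliceR_tmul ψ u _
  have h3 := congrArg (sliceR A ψ) hw
  have h4 := LinearMap.congr_fun h1 w
  have h5 := LinearMap.congr_fun h2 (Coalgebra.comul (R := ℂ) (x : A))
  exact h4.symm.trans (h3.trans h5)

theorem IsDualAct.eq_comp_transR {U : Type} [Ring U] [HopfAlgebra ℂ U]
    {pair : U →ₗ[ℂ] A →ₗ[ℂ] ℂ} {Bsub : Subalgebra ℂ A}
    (hB : ∀ φ : Module.Dual ℂ A, ∀ b ∈ Bsub, transR φ b ∈ Bsub)
    {f g : Module.Dual ℂ ↥Bsub} {k : U} (h : IsDualAct pair Bsub f k g) (b : ↥Bsub) :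
    g b = f ⟨transR (pair k) b, hB _ _ b.2⟩ := by
  obtain ⟨c, hc⟩ := mem_range_map_of_sliceR_mem Bsub.val.toLinearMap
    (Coalgebra.comul (R := ℂ) (b : A)) fun φ => ⟨⟨_, hB φ b b.2⟩, rfl⟩
  have h1 : TensorProduct.lift (((LinearMap.mul ℂ ℂ) ∘ₗ f).compl₂ (pair k)) =
      f ∘ₗ sliceR Bsub (pair k) := by
    ext u v
    simp [mul_comm]
  have h2 : Bsub.val.toLinearMap ∘ₗ sliceR Bsub (pair k) =
      sliceR A (pair k) ∘ₗ TensorProduct.map Bsub.val.toLinearMap LinearMap.id := by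
    ext u v
    simp
  rw [h b c hc, h1, LinearMap.comp_apply]
  congr 1
  refine Subtype.ext ?_
  have h3 := LinearMap.congr_fun h2 c
  rw [LinearMap.comp_apply, LinearMap.comp_apply, hc] at h3
  exact h3

end RightTranslation

namespace QslnFun

variable {q : ℝ} {N : ℕ} {D : UqslData q N} (P : QslnFun q N D)

theorem hitL_transR (k : D.U) (φ : Module.Dual ℂ P.A) (a : P.A) :
    P.hitL k (transR φ a) = transR φ (P.hitL k a) := by
  have h := Coalgebra.coassoc_apply (R := ℂ) a
  have h1 : P.hitL k ∘ₗ sliceR P.A φ =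
      TensorProduct.lift ((LinearMap.lsmul ℂ P.A).comp (P.pair k)) ∘ₗ
      TensorProduct.map LinearMap.id (sliceR P.A φ) ∘ₗ
      (TensorProduct.assoc ℂ P.A P.A P.A).toLinearMap ∘ₗ
      TensorProduct.map (Coalgebra.comul (R := ℂ)) LinearMap.id := by
    have h3 : TensorProduct.map LinearMap.id (sliceR P.A φ) ∘ₗ
        (TensorProduct.assoc ℂ P.A P.A P.A).toLinearMap = sliceR (P.A ⊗[ℂ] P.A) φ := by
      ext x y z
      simp
    ext x y
    have := LinearMap.congr_fun h3 (Coalgebra.comul (R := ℂ) x ⊗ₜ y)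
    simp only [LinearMap.comp_apply, LinearEquiv.coe_coe] at this
    simp [hitL, this]
  have h2 : transR φ ∘ₗ TensorProduct.lift ((LinearMap.lsmul ℂ P.A).comp (P.pair k)) =
      TensorProduct.lift ((LinearMap.lsmul ℂ P.A).comp (P.pair k)) ∘ₗ
      TensorProduct.map LinearMap.id (sliceR P.A φ) ∘ₗ
      TensorProduct.map LinearMap.id (Coalgebra.comul (R := ℂ)) := by
    ext x y
    simp [transR]
  calc P.hitL k (transR φ a) = (P.hitL k ∘ₗ sliceR P.A φ) (Coalgebra.comul (R := ℂ) a) := rfl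
    _ = (transR φ ∘ₗ TensorProduct.lift ((LinearMap.lsmul ℂ P.A).comp (P.pair k)))
        (Coalgebra.comul (R := ℂ) a) := by
      rw [h1, h2]
      exact congrArg (fun z => TensorProduct.lift ((LinearMap.lsmul ℂ P.A).comp (P.pair k))
        (TensorProduct.map LinearMap.id (sliceR P.A φ) z)) h

theorem counit_hitL (k : D.U) (a : P.A) :
    Coalgebra.counit (R := ℂ) (P.hitL k a) = P.pair k a := by
  have h := Coalgebra.lTensor_counit_comul (R := ℂ) a
  have h1 : (Coalgebra.counit (R := ℂ)) ∘ₗ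
      TensorProduct.lift ((LinearMap.lsmul ℂ P.A).comp (P.pair k)) = P.pair k ∘ₗ
      (TensorProduct.rid ℂ P.A).toLinearMap ∘ₗ (Coalgebra.counit (R := ℂ)).lTensor P.A := by
    ext x y
    simp [mul_comm]
  have := LinearMap.congr_fun h1 (Coalgebra.comul (R := ℂ) a)
  simpa [hitL, h] using this

theorem transR_mem_Bmod (r : ℕ) (φ : Module.Dual ℂ P.A) {b : P.A} (hb : b ∈ P.Bmod r) :
    transR φ b ∈ P.Bmod r := by
  simp only [Bmod, Submodule.mem_iInf, LinearMap.mem_ker] at hb ⊢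
  intro k
  rw [hitL_transR, hb k, map_zero]

theorem pair_eq_of_mem_Bmod {r : ℕ} {k : D.U} (hk : k ∈ D.Ksub r) {b : P.A}
    (hb : b ∈ P.Bmod r) :
    P.pair k b = Coalgebra.counit (R := ℂ) k * Coalgebra.counit (R := ℂ) b := by
  simp only [Bmod, Submodule.mem_iInf, LinearMap.mem_ker] at hb
  have h := congrArg (Coalgebra.counit (R := ℂ)) (hb ⟨k, hk⟩)
  rw [counit_hitL, Algebra.algebraMap_eq_smul_one] at h
  simpa [P.pair_oneU, sub_eq_zero] using h

theorem pair_mul_apply (x y : D.U) (a : P.A) :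
    P.pair (x * y) a = P.pair x (transR (P.pair y) a) := by
  have h : LinearMap.mul' ℂ ℂ ∘ₗ TensorProduct.map (P.pair x) (P.pair y) =
      P.pair x ∘ₗ sliceR P.A (P.pair y) := by
    ext u v
    simp [mul_comm]
  rw [P.pair_mulU]
  exact LinearMap.congr_fun h _

theorem transR_pair_mul (x y : D.U) (a : P.A) :
    transR (P.pair (x * y)) a = transR (P.pair x) (transR (P.pair y) a) := by
  rw [transR_transR]
  congr 1
  congr 1
  ext a
  exact P.pair_mul_apply x y a

theorem transR_pair_one (a : P.A) : transR (P.pair 1) a = a := by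
  have : P.pair 1 = Coalgebra.counit (R := ℂ) := by
    ext a
    exact P.pair_oneU a
  rw [this, transR_counit]

theorem pair_mul_of_groupLike {g : D.U} (hg : Coalgebra.comul (R := ℂ) g = g ⊗ₜ[ℂ] g)
    (a b : P.A) : P.pair g (a * b) = P.pair g a * P.pair g b := by
  simp [P.pair_mulA, hg]

variable {P} {r : ℕ} {Bsub : Subalgebra ℂ P.A}

theorem transR_mem (hB : Subalgebra.toSubmodule Bsub = P.Bmod r) (φ : Module.Dual ℂ P.A) :
    ∀ b ∈ Bsub, transR φ b ∈ Bsub := by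
  intro b hb
  rw [← Subalgebra.mem_toSubmodule, hB] at hb ⊢
  exact P.transR_mem_Bmod r φ hb

/-- The operator `b ↦ b₍₀₎ ⟨k, b₍₁₎⟩` on `B`. -/
def actB (hB : Subalgebra.toSubmodule Bsub = P.Bmod r) (k : D.U) : ↥Bsub →ₗ[ℂ] ↥Bsub :=
  (transR (P.pair k)).restrict (p := Subalgebra.toSubmodule Bsub)
    (q := Subalgebra.toSubmodule Bsub) (transR_mem hB _)

@[simp] theorem coe_actB (hB : Subalgebra.toSubmodule Bsub = P.Bmod r) (k : D.U) (b : ↥Bsub) :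
    (actB hB k b : P.A) = transR (P.pair k) b := rfl

/-- `T^ε` is stable under the action of the group-like elements of `K`. -/
theorem comp_actB_mem (hB : Subalgebra.toSubmodule Bsub = P.Bmod r) {I : Submodule ℂ ↥Bsub}
    (hI : DbarStable Bsub I) {g : D.U} (hgK : g ∈ D.Ksub r)
    (hg : Coalgebra.comul (R := ℂ) g = g ⊗ₜ[ℂ] g) (hg1 : Coalgebra.counit (R := ℂ) g = 1)
    {f : Module.Dual ℂ ↥Bsub} (hf : f ∈ TanOfIdeal Bsub I ⊔ Submodule.span ℂ {counitB Bsub}) :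
    f ∘ₗ actB hB g ∈ TanOfIdeal Bsub I ⊔ Submodule.span ℂ {counitB Bsub} := by
  have hpair {b : P.A} (hb : b ∈ Bsub) : P.pair g b = Coalgebra.counit (R := ℂ) b := by
    rw [← Subalgebra.mem_toSubmodule, hB] at hb
    rw [P.pair_eq_of_mem_Bmod hgK hb, hg1, one_mul]
  have hvanish : ∀ a ∈ ABp Bsub, P.pair g a = 0 := by
    intro a ha
    induction ha using Submodule.span_induction with
    | mem x hx =>
      obtain ⟨a, b, hb, hb0, rfl⟩ := hx
      rw [P.pair_mul_of_groupLike hg, hpair hb, hb0, mul_zero]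
    | zero => simp
    | add x y _ _ hx hy => simp [hx, hy]
    | smul c x _ hx => simp [hx]
  obtain ⟨f₁, hf₁, f₂, hf₂, rfl⟩ := Submodule.mem_sup.mp hf
  obtain ⟨c, rfl⟩ := Submodule.mem_span_singleton.mp hf₂
  rw [LinearMap.add_comp, LinearMap.smul_comp]
  refine Submodule.add_mem_sup ?_ ?_
  · simp only [TanOfIdeal, Submodule.mem_inf, Submodule.mem_iInf, LinearMap.mem_ker,
      Module.Dual.eval_apply, LinearMap.comp_apply] at hf₁ ⊢
    refine ⟨fun x => ?_, ?_⟩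
    · obtain ⟨y, hy, hyx⟩ := transR_mem_of_DbarStable hI hvanish x.2
      have : actB hB g x = y := Subtype.ext hyx.symm
      rw [this]
      exact hf₁.1 ⟨y, hy⟩
    · have : actB hB g 1 = 1 :=
        Subtype.ext (transR_one (by rw [P.pair_oneA, hg1]))
      rw [this]
      exact hf₁.2
  · have : counitB Bsub ∘ₗ actB hB g = counitB Bsub := by
      ext b
      exact (counit_transR _ _).trans (hpair b.2)
    rw [this]
    exact Submodule.smul_mem _ _ (Submodule.mem_span_singleton_self _)

end QslnFun

/-- Lemma `KinvT`.  Let `T` be the quantum tangent space of a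
covariant first order differential calculus over `B` (given by the left ideal `I`),
let `{t_i}` be a basis of `T^ε = T ⊕ ℂε`, let `a_{ij} ∈ B°` be defined by
`Δ(t_i) = Σ_j a_{ij} ⊗ t_j`, and let `T' ⊆ B°` be the subcoalgebra generated by the
`a_{ij}` (i.e. their linear span).  If `K' ⊂ U_q(sl_N)` denotes the commutative
subalgebra generated by `K₁, …, K_{N-1}`, then `T′·K′ ⊆ T′`. -/
theorem Tprime_Kprime_stable
    (q : ℝ) (hq : Transcendental ℚ q)
    (N r : ℕ) (hN : 2 ≤ N) (hr1 : 1 ≤ r) (hr2 : r ≤ N - 1)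
    (D : UqslData q N) (P : QslnFun q N D)
    (Bsub : Subalgebra ℂ P.A) (hB : Subalgebra.toSubmodule Bsub = P.Bmod r)
    (I : Submodule ℂ ↥Bsub) (hI : FODCIdeal Bsub I)
    (n : ℕ) (t : Fin n → Module.Dual ℂ ↥Bsub)
    (htind : LinearIndependent ℂ t)
    (htspan : Submodule.span ℂ (Set.range t) =
      TanOfIdeal Bsub I ⊔ Submodule.span ℂ {counitB Bsub})
    (a : Fin n → Fin n → Module.Dual ℂ ↥Bsub)
    (ha : ∀ (i : Fin n) (b c : ↥Bsub), t i (b * c) = ∑ j, a i j b * t j c) :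
    ∀ f ∈ Submodule.span ℂ {g : Module.Dual ℂ ↥Bsub | ∃ i j, g = a i j},
      ∀ k ∈ Algebra.adjoin ℂ {x : D.U | ∃ l ∈ Finset.Icc 1 (N - 1), x = D.Kg l},
        ∀ g : Module.Dual ℂ ↥Bsub, IsDualAct P.pair Bsub f k g →
          g ∈ Submodule.span ℂ {g' : Module.Dual ℂ ↥Bsub | ∃ i j, g' = a i j} := by
  let W := Submodule.span ℂ {g : Module.Dual ℂ ↥Bsub | ∃ i j, g = a i j}
  have hKg : ∀ l ∈ Finset.Icc 1 (N - 1), ∀ f ∈ W, f ∘ₗ QslnFun.actB hB (D.Kg l) ∈ W := by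
    intro l hl
    have ht (g : D.U) (hgK : g ∈ D.Ksub r) (hg : Coalgebra.comul (R := ℂ) g = g ⊗ₜ[ℂ] g)
        (hg1 : Coalgebra.counit (R := ℂ) g = 1) (i : Fin n) :
        t i ∘ₗ QslnFun.actB hB g ∈ Submodule.span ℂ (Set.range t) := by
      rw [htspan]
      refine QslnFun.comp_actB_mem hB hI.2.2 hgK hg hg1 ?_
      rw [← htspan]
      exact Submodule.subset_span ⟨i, rfl⟩
    have hcoeff (i j : Fin n) : a i j ∘ₗ QslnFun.actB hB (D.Kg l) ∈ W := by
      refine matrixCoeff_comp_mem_span htind ha _ (QslnFun.actB hB (D.Ki l))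
        (fun b c => Subtype.ext (transR_mul (P.pair_mul_of_groupLike (D.comul_Kg l hl)) _ _))
        (fun b => Subtype.ext ?_)
        (ht _ (Algebra.subset_adjoin (Or.inr ⟨l, hl, Or.inl rfl⟩)) (D.comul_Kg l hl)
          (D.counit_Kg l hl))
        (ht _ (Algebra.subset_adjoin (Or.inr ⟨l, hl, Or.inr rfl⟩)) (D.comul_Ki l hl)
          (D.counit_Ki l hl)) i j
      rw [QslnFun.coe_actB, QslnFun.coe_actB, ← P.transR_pair_mul, (D.rels.1 l hl).1,
        P.transR_pair_one]
    intro f hf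
    induction hf using Submodule.span_induction with
    | mem x hx =>
      obtain ⟨i, j, rfl⟩ := hx
      exact hcoeff i j
    | zero => simp
    | add x y _ _ hx hy =>
      rw [LinearMap.add_comp]
      exact W.add_mem hx hy
    | smul c x _ hx =>
      rw [LinearMap.smul_comp]
      exact W.smul_mem c hx
  intro f hf k hk g hg
  have hgf : g = f ∘ₗ QslnFun.actB hB k :=
    LinearMap.ext fun b => hg.eq_comp_transR (QslnFun.transR_mem hB) b
  rw [hgf]
  clear hg hgf
  change f ∈ W at hf
  change _ ∈ W
  induction hk using Algebra.adjoin_induction generalizing f with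
  | mem x hx =>
    obtain ⟨l, hl, rfl⟩ := hx
    exact hKg l hl f hf
  | algebraMap c =>
    have : f ∘ₗ QslnFun.actB hB (algebraMap ℂ D.U c) = c • f := by
      ext b
      have hb : QslnFun.actB hB (algebraMap ℂ D.U c) b = c • b := by
        refine Subtype.ext ?_
        rw [QslnFun.coe_actB, Algebra.algebraMap_eq_smul_one]
        have : transR (P.pair (c • 1)) (b : P.A) = c • transR (P.pair 1) (b : P.A) := by
          simp [transR, sliceR, TensorProduct.map_smul_right]
        rw [this, P.transR_pair_one]
        rfl
      simp [hb]
    rw [this]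
    exact W.smul_mem c hf
  | add x y _ _ hx hy =>
    have : f ∘ₗ QslnFun.actB hB (x + y) =
        f ∘ₗ QslnFun.actB hB x + f ∘ₗ QslnFun.actB hB y := by
      ext b
      rw [LinearMap.add_apply, LinearMap.comp_apply, LinearMap.comp_apply, LinearMap.comp_apply,
        ← map_add]
      congr 1
      refine Subtype.ext ?_
      simp [transR, sliceR, TensorProduct.map_add_right]
    rw [this]
    exact W.add_mem (hx f hf) (hy f hf)
  | mul x y _ _ hx hy =>
    have : f ∘ₗ QslnFun.actB hB (x * y) =
        (f ∘ₗ QslnFun.actB hB x) ∘ₗ QslnFun.actB hB y := by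
      ext b
      rw [LinearMap.comp_apply, LinearMap.comp_apply, LinearMap.comp_apply]
      congr 1
      exact Subtype.ext (P.transR_pair_mul x y b)
    rw [this]
    exact hy _ (hx f hf)
end
end

section
/- Let W be a finite-dimensional representation of B = O_q(Gr(r,N)) on which all off-diagonal generators z_ij (i ≠ j) act nilpotently. Then the commutative nonunital subring V₀⁺ ⊂ B⁺ also acts nilpotently on W; in fact every common eigenvector v of the z_ii satisfies (z_ii − ε(z_ii))v = 0 for all i. -/
noncomputable section

open scoped TensorProduct

open Finset

/-- The partial products `Σ_{k < b} q^{-2k} z_{dk} z_{ka}`. -/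
def partialProd {V : Type*} [Ring V] [Algebra ℂ V] (Q : ℂ) (z : ℕ → ℕ → V) (b d a : ℕ) : V :=
  ∑ k ∈ Ico 1 b, (Q ^ (2 * k))⁻¹ • (z d k * z k a)

/-- The reflection-equation relations with the entries of `R̂` written out. -/
def ReflectionRel {V : Type*} [Ring V] [Algebra ℂ V] (Q : ℂ) (N : ℕ) (z : ℕ → ℕ → V) : Prop :=
  ∀ a ∈ Icc 1 N, ∀ b ∈ Icc 1 N, ∀ c ∈ Icc 1 N, ∀ d ∈ Icc 1 N,
    ((if c = b then Q else 1) * (if c = d then Q else 1)) • (z d b * z c a) +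
      (if c < d then (Q - Q⁻¹) * (if d = b then Q else 1) else 0) • (z c b * z d a) +
      (if b = c then (if b = d then Q else 1) * (Q - Q⁻¹) * Q ^ (2 * b) else 0) •
        partialProd Q z b d a +
      (if b = d ∧ c < d then (Q - Q⁻¹) * (Q - Q⁻¹) * Q ^ (2 * b) else 0) •
        partialProd Q z b c a =
    ((if d = a then Q else 1) * (if a = b then Q else 1)) • (z c a * z d b) +
      (if a < b then (Q - Q⁻¹) * (if d = b then Q else 1) else 0) • (z c b * z d a) +
      (if a = d then (if a = b then Q else 1) * (Q - Q⁻¹) * Q ^ (2 * d) else 0) •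
        partialProd Q z d c b +
      (if b = d ∧ a < b then (Q - Q⁻¹) * (Q - Q⁻¹) * Q ^ (2 * b) else 0) •
        partialProd Q z b c a

section Rhat

variable {V : Type*} [AddCommGroup V] [Module ℂ V] {q : ℝ} {N : ℕ}

theorem Rhat_eq (q : ℝ) (i j k l : ℕ) :
    Rhat q i j k l = (if i = l then (if j = k then (if i = j then (q : ℂ) else 1) else 0) else 0) +
      (if i = k then (if j = l then (if i < j then (q : ℂ) - (q : ℂ)⁻¹ else 0) else 0) else 0) := by
  unfold Rhat
  simp only [ite_and]
  split_ifs <;> simp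

theorem sum_Rhat_lower_s17 (f : ℕ → ℕ → V) {k b : ℕ} (hk : k ∈ Icc 1 N) (hb : b ∈ Icc 1 N) :
    ∑ j ∈ Icc 1 N, ∑ l ∈ Icc 1 N, Rhat q k b j l • f j l =
      (if k = b then (q : ℂ) else 1) • f b k +
        (if k < b then (q : ℂ) - (q : ℂ)⁻¹ else 0) • f k b := by
  have hk' := mem_Icc.1 hk
  have hb' := mem_Icc.1 hb
  simp only [Rhat_eq, add_smul, sum_add_distrib, ite_smul, zero_smul, sum_ite_eq, sum_ite_irrel,
    sum_const_zero, hk, hb, if_true]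

theorem sum_Rhat_upper_s17 (f : ℕ → ℕ → V) {c d : ℕ} (hc : c ∈ Icc 1 N) (hd : d ∈ Icc 1 N) :
    ∑ i ∈ Icc 1 N, ∑ k ∈ Icc 1 N, Rhat q i k c d • f i k =
      (if c = d then (q : ℂ) else 1) • f d c +
        (if c < d then (q : ℂ) - (q : ℂ)⁻¹ else 0) • f c d := by
  simp only [Rhat_eq, add_smul, sum_add_distrib, ite_smul, zero_smul, sum_ite_eq', sum_ite_irrel,
    sum_const_zero, hc, hd, if_true]
  simp only [eq_comm]

theorem sum_Rhat_first (f : ℕ → V) {b c d : ℕ} (hc : c ∈ Icc 1 N) (hd : d ∈ Icc 1 N) :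
    ∑ i ∈ Icc 1 N, Rhat q i b c d • f i =
      (if b = c then (if b = d then (q : ℂ) else 1) else 0) • f d +
        (if b = d ∧ c < d then (q : ℂ) - (q : ℂ)⁻¹ else 0) • f c := by
  simp only [Rhat_eq, add_smul, sum_add_distrib, ite_smul, zero_smul, sum_ite_eq',
    hc, hd, if_true]
  by_cases h : b = d <;> simp [h, eq_comm]

theorem sum_Rhat_diag (f : ℕ → ℕ → V) {l d : ℕ} (hl : l ∈ Icc 1 N) (hd : d ∈ Icc 1 N) :
    ∑ i ∈ Icc 1 N, ∑ j ∈ Icc 1 N, Rhat q j l i d • f i j =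
      (if d = l then (q : ℂ) else 1) • f l d +
        (if l = d then (q : ℂ) - (q : ℂ)⁻¹ else 0) • ∑ j ∈ Ico 1 l, f j j := by
  have hl' := mem_Icc.1 hl
  have hI : Ico 1 l = (Icc 1 N).filter (· < l) := by
    ext x
    simp only [mem_Ico, mem_filter, mem_Icc]
    omega
  have h1 : ∑ i ∈ Icc 1 N, ∑ j ∈ Icc 1 N, (if j = d then (if l = i then
      (if j = l then (q : ℂ) else 1) else 0) else 0) • f i j =
      (if d = l then (q : ℂ) else 1) • f l d := by
    simp only [ite_smul, zero_smul, sum_ite_eq, sum_ite_eq', hl, hd, if_true]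
  have h2 : ∑ i ∈ Icc 1 N, ∑ j ∈ Icc 1 N, (if j = i then (if l = d then
      (if j < l then (q : ℂ) - (q : ℂ)⁻¹ else 0) else 0) else 0) • f i j =
      (if l = d then (q : ℂ) - (q : ℂ)⁻¹ else 0) • ∑ j ∈ Ico 1 l, f j j := by
    rw [hI, sum_filter, smul_sum]
    refine sum_congr rfl fun i hi => ?_
    simp only [ite_smul, zero_smul, sum_ite_eq', hi, if_true, smul_ite, smul_zero]
    split_ifs <;> simp
  rw [← h1, ← h2, ← sum_add_distrib]
  refine sum_congr rfl fun i _ => ?_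
  rw [← sum_add_distrib]
  refine sum_congr rfl fun j _ => ?_
  rw [Rhat_eq, add_smul]

end Rhat

theorem zpow_two_sub {Q : ℂ} (hQ : Q ≠ 0) (b k : ℕ) :
    Q ^ (2 * (b : ℤ) - 2 * (k : ℤ)) = Q ^ (2 * b) * (Q ^ (2 * k))⁻¹ := by
  rw [zpow_sub₀ hQ, div_eq_mul_inv]
  norm_cast

theorem GrassRels.reflectionRel {q : ℝ} (hq : q ≠ 0) {N r : ℕ} {V : Type} [Ring V] [Algebra ℂ V]
    {z : ℕ → ℕ → V} (h : GrassRels q N r z) : ReflectionRel (q : ℂ) N z := by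
  intro a ha b hb c hc d hd
  have hQ : (q : ℂ) ≠ 0 := by exact_mod_cast hq
  have key := h.1 a ha b hb c hc d hd
  have hI : ∀ b ∈ Icc 1 N, Ico 1 b = (Icc 1 N).filter (· < b) := by
    intro b hb
    rw [mem_Icc] at hb
    ext x
    simp only [mem_Ico, mem_filter, mem_Icc]
    omega
  have hL : (∑ i ∈ Icc 1 N, ∑ j ∈ Icc 1 N, ∑ k ∈ Icc 1 N, ∑ l ∈ Icc 1 N,
      ((q : ℂ) ^ (2 * (b : ℤ) - 2 * (j : ℤ)) * Rhat q k b j l * Rhat q i l c d) •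
        (z i j * z k a)) =
      ∑ i ∈ Icc 1 N, ∑ k ∈ Icc 1 N, Rhat q i k c d • ((if k = b then (q : ℂ) else 1) •
        (z i b * z k a)) +
      ((q : ℂ) - (q : ℂ)⁻¹) • (q : ℂ) ^ (2 * b) •
        ∑ i ∈ Icc 1 N, Rhat q i b c d • partialProd (q : ℂ) z b i a := by
    simp only [partialProd, smul_sum]
    rw [← sum_add_distrib]
    refine sum_congr rfl fun i _ => ?_
    rw [sum_comm, hI b hb, sum_filter, ← sum_add_distrib]
    refine sum_congr rfl fun k hk => ?_
    have := sum_Rhat_lower_s17 (q := q) (fun j l => ((q : ℂ) ^ (2 * (b : ℤ) - 2 * (j : ℤ)) *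
      Rhat q i l c d) • (z i j * z k a)) hk hb
    simp only [smul_smul] at this
    rw [show (∑ j ∈ Icc 1 N, ∑ l ∈ Icc 1 N, ((q : ℂ) ^ (2 * (b : ℤ) - 2 * (j : ℤ)) *
      Rhat q k b j l * Rhat q i l c d) • (z i j * z k a)) = _ from
      (sum_congr rfl fun j _ => sum_congr rfl fun l _ => by congr 1; ring).trans this]
    simp only [zpow_two_sub hQ]
    rw [mul_inv_cancel₀ (pow_ne_zero _ hQ)]
    split_ifs <;> simp only [smul_smul] <;> module
  have hR : (∑ i ∈ Icc 1 N, ∑ j ∈ Icc 1 N, ∑ k ∈ Icc 1 N, ∑ l ∈ Icc 1 N,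
      ((q : ℂ) ^ (2 * (l : ℤ) - 2 * (i : ℤ)) * Rhat q j l i d * Rhat q a b k l) •
        (z c i * z j k)) =
      (if a = b then (q : ℂ) else 1) • ∑ i ∈ Icc 1 N, ∑ j ∈ Icc 1 N, Rhat q j a i d •
        (((q : ℂ) ^ (2 * a) * ((q : ℂ) ^ (2 * i))⁻¹) • (z c i * z j b)) +
      (if a < b then (q : ℂ) - (q : ℂ)⁻¹ else 0) • ∑ i ∈ Icc 1 N, ∑ j ∈ Icc 1 N, Rhat q j b i d •
        (((q : ℂ) ^ (2 * b) * ((q : ℂ) ^ (2 * i))⁻¹) • (z c i * z j a)) := by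
    simp only [smul_sum]
    rw [← sum_add_distrib]
    refine sum_congr rfl fun i _ => ?_
    rw [← sum_add_distrib]
    refine sum_congr rfl fun j _ => ?_
    have := sum_Rhat_lower_s17 (q := q) (fun k l => ((q : ℂ) ^ (2 * (l : ℤ) - 2 * (i : ℤ)) *
      Rhat q j l i d) • (z c i * z j k)) ha hb
    simp only [smul_smul] at this
    rw [show (∑ k ∈ Icc 1 N, ∑ l ∈ Icc 1 N, ((q : ℂ) ^ (2 * (l : ℤ) - 2 * (i : ℤ)) *
      Rhat q j l i d * Rhat q a b k l) • (z c i * z j k)) = _ from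
      (sum_congr rfl fun k _ => sum_congr rfl fun l _ => by congr 1; ring).trans this]
    simp only [zpow_two_sub hQ, smul_smul]
    congr 2 <;> ring
  rw [hL, hR, sum_Rhat_upper_s17 _ hc hd, sum_Rhat_first _ hc hd, sum_Rhat_diag _ ha hd,
    sum_Rhat_diag _ hb hd] at key
  simp only [← smul_smul, ← smul_sum, ← partialProd.eq_1] at key
  rw [smul_inv_smul₀ (pow_ne_zero _ hQ), smul_inv_smul₀ (pow_ne_zero _ hQ)] at key
  refine (Eq.trans ?_ key).trans ?_
  · split_ifs <;> first | (exfalso; omega) | module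
  · split_ifs <;> first | (exfalso; omega) | (subst_vars; module)

section Operators

variable {W : Type*} [AddCommGroup W] [Module ℂ W] {Q : ℂ} {N s p : ℕ}
  {z : ℕ → ℕ → Module.End ℂ W}

theorem partialProd_apply (b d a : ℕ) (v : W) :
    partialProd Q z b d a v = ∑ k ∈ Ico 1 b, (Q ^ (2 * k))⁻¹ • z d k (z k a v) := by
  simp [partialProd, LinearMap.sum_apply]

theorem partialProd_succ_apply {b : ℕ} (hb : 1 ≤ b) (d a : ℕ) (v : W) :
    partialProd Q z (b + 1) d a v =
      partialProd Q z b d a v + (Q ^ (2 * b))⁻¹ • z d b (z b a v) := by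
  rw [partialProd_apply, partialProd_apply, sum_Ico_succ_top hb]

theorem partialProd_apply_eq_zero {b d a : ℕ} {v : W}
    (h : ∀ k, 1 ≤ k → k < b → z d k (z k a v) = 0) : partialProd Q z b d a v = 0 := by
  rw [partialProd_apply]
  refine sum_eq_zero fun k hk => ?_
  rw [mem_Ico] at hk
  rw [h k hk.1 hk.2, smul_zero]

theorem partialProd_apply_eq_of_le {b c d a : ℕ} {v : W} (hb : 1 ≤ b) (hbc : b ≤ c)
    (h : ∀ k, b ≤ k → k < c → z d k (z k a v) = 0) :
    partialProd Q z c d a v = partialProd Q z b d a v := by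
  rw [partialProd_apply, partialProd_apply, ← sum_Ico_consecutive _ hb hbc, add_eq_left]
  refine sum_eq_zero fun k hk => ?_
  rw [mem_Ico] at hk
  rw [h k hk.1 hk.2, smul_zero]

theorem ReflectionRel.apply (hz : ReflectionRel Q N z) (a b c d : ℕ) (v : W)
    (ha : 1 ≤ a ∧ a ≤ N := by omega) (hb : 1 ≤ b ∧ b ≤ N := by omega)
    (hc : 1 ≤ c ∧ c ≤ N := by omega) (hd : 1 ≤ d ∧ d ≤ N := by omega) :
    ((if c = b then Q else 1) * (if c = d then Q else 1)) • z d b (z c a v) +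
      (if c < d then (Q - Q⁻¹) * (if d = b then Q else 1) else 0) • z c b (z d a v) +
      (if b = c then (if b = d then Q else 1) * (Q - Q⁻¹) * Q ^ (2 * b) else 0) •
        partialProd Q z b d a v +
      (if b = d ∧ c < d then (Q - Q⁻¹) * (Q - Q⁻¹) * Q ^ (2 * b) else 0) •
        partialProd Q z b c a v =
    ((if d = a then Q else 1) * (if a = b then Q else 1)) • z c a (z d b v) +
      (if a < b then (Q - Q⁻¹) * (if d = b then Q else 1) else 0) • z c b (z d a v) +
      (if a = d then (if a = b then Q else 1) * (Q - Q⁻¹) * Q ^ (2 * d) else 0) •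
        partialProd Q z d c b v +
      (if b = d ∧ a < b then (Q - Q⁻¹) * (Q - Q⁻¹) * Q ^ (2 * b) else 0) •
        partialProd Q z b c a v := by
  have h := DFunLike.congr_fun
    (hz a (mem_Icc.2 ha) b (mem_Icc.2 hb) c (mem_Icc.2 hc) d (mem_Icc.2 hd)) v
  simpa only [LinearMap.add_apply, LinearMap.smul_apply, Module.End.mul_apply] using h

theorem ReflectionRel.diag_comm (hz : ReflectionRel Q N z) {i j : ℕ} (hi : 1 ≤ i ∧ i ≤ N)
    (hj : 1 ≤ j ∧ j ≤ N) (v : W) : z i i (z j j v) = z j j (z i i v) := by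
  wlog hij : i < j generalizing i j
  · rcases eq_or_lt_of_le (not_lt.1 hij) with rfl | h
    · rfl
    · exact (this hj hi h).symm
  have h := hz.apply i j i j v
  simp [hij, hij.ne, hij.ne'] at h
  exact h.symm

/-- Entries below the diagonal of a common column `q`-commute. -/
theorem ReflectionRel.column_comm (hz : ReflectionRel Q N z) (hQ : Q ≠ 0) {j m n : ℕ}
    (hj : 1 ≤ j) (hjm : j < m) (hmn : m < n) (hn : n ≤ N) (v : W) :
    z n j (z m j v) = Q⁻¹ • z m j (z n j v) := by
  have h := hz.apply j j m n v
  simp [hmn, hmn.ne, hjm.ne, hjm.ne', (hjm.trans hmn).ne, (hjm.trans hmn).ne'] at h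
  linear_combination (norm := skip) h
  match_scalars <;> field_simp <;> ring

/-- Entries to the right of the diagonal of a common row `q`-commute. -/
theorem ReflectionRel.row_comm (hz : ReflectionRel Q N z) {j m n : ℕ}
    (hj : 1 ≤ j) (hjm : j < m) (hmn : m < n) (hn : n ≤ N) (v : W) :
    z j n (z j m v) = Q • z j m (z j n v) := by
  have h := hz.apply n m j j v
  simp [hmn.ne', hmn.not_gt, hjm.ne, hjm.ne', (hjm.trans hmn).ne,
    (hjm.trans hmn).ne'] at h
  exact h.symm

/-- `U` is stable under the `z_{ij}`, and those with an index below `p` vanish on it. -/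
structure SupportedFrom (N : ℕ) (z : ℕ → ℕ → Module.End ℂ W) (p : ℕ) (U : Submodule ℂ W) :
    Prop where
  mapsTo : ∀ i j, 1 ≤ i ∧ i ≤ N → 1 ≤ j ∧ j ≤ N → ∀ v ∈ U, z i j v ∈ U
  eq_zero : ∀ i j, 1 ≤ i ∧ i ≤ N → 1 ≤ j ∧ j ≤ N → i < p ∨ j < p → ∀ v ∈ U, z i j v = 0

namespace SupportedFrom

variable {U : Submodule ℂ W}

theorem partialProd_eq_zero (hU : SupportedFrom N z p U) (hp : p ≤ N) {b d a : ℕ} (hbp : b ≤ p)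
    (ha : 1 ≤ a ∧ a ≤ N) (hd : 1 ≤ d ∧ d ≤ N) {v : W} (hv : v ∈ U) :
    partialProd Q z b d a v = 0 :=
  partialProd_apply_eq_zero fun k h1 hk =>
    hU.eq_zero _ _ hd (by omega) (by omega) _ (hU.mapsTo _ _ (by omega) ha _ hv)

theorem corner_column (hU : SupportedFrom N z p U) (hz : ReflectionRel Q N z) (hQ : Q ≠ 0)
    (hp : 1 ≤ p) {d : ℕ} (hpd : p < d) (hd : d ≤ N) {v : W} (hv : v ∈ U) :
    z p p (z d p v) = Q ^ 2 • z d p (z p p v) := by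
  have h := hz.apply p p p d v
  rw [hU.partialProd_eq_zero (by omega) le_rfl (by omega) (by omega) hv] at h
  simp [hpd, hpd.ne, hpd.ne'] at h
  linear_combination (norm := skip) (-Q) • h
  match_scalars <;> field_simp <;> ring

theorem corner_row (hU : SupportedFrom N z p U) (hz : ReflectionRel Q N z) (hQ : Q ≠ 0)
    (hp : 1 ≤ p) {b : ℕ} (hpb : p < b) (hb : b ≤ N) {v : W} (hv : v ∈ U) :
    z p b (z p p v) = Q ^ 2 • z p p (z p b v) := by
  have h := hz.apply p b p p v
  rw [hU.partialProd_eq_zero (by omega) le_rfl (by omega) (by omega) hv] at h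
  simp [hpb, hpb.ne, hpb.ne'] at h
  linear_combination (norm := skip) Q • h
  match_scalars <;> field_simp <;> ring

theorem corner_comm (hz : ReflectionRel Q N z)
    (hp : 1 ≤ p) {d b : ℕ} (hpd : p < d) (hd : d ≤ N) (hpb : p < b) (hb : b ≤ N) (v : W) :
    z p p (z d b v) = z d b (z p p v) := by
  have h := hz.apply p b p d v
  simp [hpd, hpd.ne, hpd.ne', hpb, hpb.ne, hpb.ne'] at h
  exact h.symm

theorem column_row (hU : SupportedFrom N z p U) (hz : ReflectionRel Q N z)
    (hp : 1 ≤ p) {d a : ℕ} (hpd : p < d) (hd : d ≤ N) (hpa : p < a) (ha : a ≤ N) {v : W}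
    (hv : v ∈ U) :
    Q • z d p (z p a v) + (Q - Q⁻¹) • z p p (z d a v) =
      (if d = a then Q else 1) • z p a (z d p v) +
        (if d = a then (Q - Q⁻¹) * Q ^ (2 * d) else 0) • partialProd Q z d p p v := by
  have h := hz.apply a p p d v
  rw [hU.partialProd_eq_zero (by omega) le_rfl (by omega) (by omega) hv] at h
  simpa [hpd, hpd.ne, hpd.ne', hpa, hpa.ne, hpa.ne', hpa.not_gt, eq_comm (a := a)] using h

theorem column_normal (hU : SupportedFrom N z p U) (hz : ReflectionRel Q N z) (hQ : Q ≠ 0)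
    (hp : 1 ≤ p) {n : ℕ} (hpn : p < n) (hn : n ≤ N)
    (hcol : ∀ i, p ≤ i → i < n → ∀ v ∈ U, z i p v = 0) {d b : ℕ} (hd : 1 ≤ d ∧ d ≤ N)
    (hb : 1 ≤ b ∧ b ≤ N) :
    ∃ κ : ℂ, (d = b → κ = 1) ∧ ∀ v ∈ U, z n p (z d b v) = κ • z d b (z n p v) := by
  have hnp : ∀ v ∈ U, z n p v ∈ U := hU.mapsTo _ _ (by omega) (by omega)
  by_cases hlow : d < p ∨ b < p
  · refine ⟨1, fun _ => rfl, fun v hv => ?_⟩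
    rw [hU.eq_zero d b hd hb hlow v hv, hU.eq_zero d b hd hb hlow _ (hnp v hv)]
    simp
  have hF : ∀ e f, e ≤ n → 1 ≤ f ∧ f ≤ N → 1 ≤ e → ∀ v ∈ U, partialProd Q z e f p v = 0 := by
    intro e f he hf he1 v hv
    refine partialProd_apply_eq_zero fun k h1 hk => ?_
    rcases lt_or_ge k p with h | h
    · rw [hU.eq_zero k p (by omega) (by omega) (Or.inl h) v hv, map_zero]
    · rw [hcol k h (by omega) v hv, map_zero]
  rcases lt_trichotomy d n with hdn | rfl | hdn
  · rcases eq_or_ne b p with rfl | hbp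
    · refine ⟨1, fun _ => rfl, fun v hv => ?_⟩
      rw [hcol d (by omega) hdn v hv, hcol d (by omega) hdn _ (hnp v hv)]
      simp
    · have hpb : p < b := by omega
      rcases eq_or_ne b d with rfl | hbd
      · refine ⟨1, fun _ => rfl, fun v hv => ?_⟩
        have h := hz.apply p b n b v
        rw [hcol b (by omega) hdn v hv, hF b n hdn.le (by omega) (by omega) v hv] at h
        simp [hdn.ne, hdn.ne', hdn.not_gt, hpb.ne, hpb.ne'] at h
        rw [one_smul, h]
      refine ⟨(if p = d then Q⁻¹ else 1) * (if n = b then Q else 1), fun h => absurd h.symm hbd,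
        fun v hv => ?_⟩
      have h := hz.apply p b n d v
      rw [hcol d (by omega) hdn v hv] at h
      rcases eq_or_ne b n with rfl | hbn
      · rw [hF _ _ le_rfl (by omega) (by omega) v hv] at h
        rcases eq_or_ne d p with rfl | hdp
        · rw [hU.partialProd_eq_zero (by omega) le_rfl (by omega) (by omega) hv] at h
          simp [hdn.ne', hdn.not_gt, hdn.ne] at h
          rw [if_pos rfl, if_pos rfl, mul_smul, h, smul_smul, inv_mul_cancel₀ hQ, one_smul]
        · simp [hdn.ne', hdn.not_gt, hdn.ne, hpb.ne, hdp, hdp.symm] at h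
          simp [hdp.symm, h]
      · rcases eq_or_ne d p with rfl | hdp
        · rw [hU.partialProd_eq_zero (by omega) le_rfl (by omega) (by omega) hv] at h
          simp [hdn.ne', hdn.not_gt, hbn, hbn.symm, hbd, hbd.symm] at h
          rw [if_pos rfl, if_neg hbn.symm, mul_one, h, smul_smul, inv_mul_cancel₀ hQ, one_smul]
        · simp [hdn.ne', hdn.not_gt, hpb.ne, hdp, hdp.symm, hbn, hbn.symm,
            hbd, hbd.symm] at h
          simp [hdp.symm, hbn.symm, h]
  · rcases eq_or_ne b p with rfl | hbp
    · exact ⟨1, fun _ => rfl, fun v _ => by rw [one_smul]⟩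
    have hpb : p < b := by omega
    rcases eq_or_ne b d with rfl | hbd
    · refine ⟨1, fun _ => rfl, fun v hv => ?_⟩
      have h := hz.apply p b b b v
      rw [hF _ _ le_rfl (by omega) (by omega) v hv] at h
      simp [hpb, hpb.ne, hpb.ne'] at h
      linear_combination (norm := skip) -h
      match_scalars <;> field_simp <;> ring
    · refine ⟨Q⁻¹, fun h => absurd h.symm hbd, fun v hv => ?_⟩
      have h := hz.apply p b d d v
      simp [hpb, hpb.ne, hpn.ne, hpn.ne', hbd, hbd.symm] at h
      linear_combination (norm := skip) -h
      match_scalars <;> field_simp <;> ring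
  · rcases eq_or_ne b p with rfl | hbp
    · refine ⟨Q, fun h => absurd h (hpn.trans hdn).ne', fun v hv => ?_⟩
      rw [hz.column_comm hQ (by omega) hpn hdn hd.2, smul_smul, mul_inv_cancel₀ hQ, one_smul]
    have hpb : p < b := by omega
    refine ⟨if n = b then Q else 1, ?_, fun v hv => ?_⟩
    · rintro rfl
      rw [if_neg hdn.ne]
    have h := hz.apply p b n d v
    rcases eq_or_ne b n with rfl | hbn
    · rw [hF _ _ le_rfl (by omega) (by omega) v hv] at h
      simp [hpb, hpb.ne, hdn, hdn.ne, hdn.ne', (hpn.trans hdn).ne,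
        (hpn.trans hdn).ne'] at h
      simp [h]
    · simp [hpb, hpb.ne, hdn, hdn.ne, (hpn.trans hdn).ne,
        (hpn.trans hdn).ne', hbn, hbn.symm] at h
      simp [hbn.symm, h]

theorem row_normal (hU : SupportedFrom N z p U) (hz : ReflectionRel Q N z) (hQ : Q ≠ 0)
    (hp : 1 ≤ p) {n : ℕ} (hpn : p < n) (hn : n ≤ N)
    (hrow : ∀ i, p ≤ i → i < n → ∀ v ∈ U, z p i v = 0) {d b : ℕ} (hd : 1 ≤ d ∧ d ≤ N)
    (hb : 1 ≤ b ∧ b ≤ N) :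
    ∃ κ : ℂ, (d = b → κ = 1) ∧ ∀ v ∈ U, z p n (z d b v) = κ • z d b (z p n v) := by
  have hnp : ∀ v ∈ U, z p n v ∈ U := hU.mapsTo _ _ (by omega) (by omega)
  by_cases hlow : d < p ∨ b < p
  · refine ⟨1, fun _ => rfl, fun v hv => ?_⟩
    rw [hU.eq_zero d b hd hb hlow v hv, hU.eq_zero d b hd hb hlow _ (hnp v hv)]
    simp
  have hF : ∀ e f, e ≤ n → 1 ≤ f ∧ f ≤ N → 1 ≤ e → ∀ v ∈ U, partialProd Q z e p f v = 0 := by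
    intro e f he hf he1 v hv
    refine partialProd_apply_eq_zero fun k h1 hk => ?_
    have hkv : z k f v ∈ U := hU.mapsTo _ _ (by omega) hf v hv
    rcases lt_or_ge k p with h | h
    · exact hU.eq_zero p k (by omega) (by omega) (Or.inr h) _ hkv
    · exact hrow k h (by omega) _ hkv
  have hrow' : b < n → ∀ v ∈ U, z p b (z d n v) = 0 := fun hbn v hv =>
    hrow b (by omega) hbn _ (hU.mapsTo _ _ hd (by omega) v hv)
  rcases lt_trichotomy b n with hbn | rfl | hbn
  · rcases eq_or_ne d p with rfl | hdp
    · refine ⟨1, fun _ => rfl, fun v hv => ?_⟩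
      rw [hrow b (by omega) hbn v hv, hrow b (by omega) hbn _ (hnp v hv)]
      simp
    have hpd : p < d := by omega
    rcases eq_or_ne d b with rfl | hdb
    · refine ⟨1, fun _ => rfl, fun v hv => ?_⟩
      have h := hz.apply n d p d v
      rw [hF _ _ hbn.le (by omega) (by omega) v hv, hrow' hbn v hv] at h
      simp [hbn.ne, hbn.ne', hbn.not_gt, hpd.ne, hpd.ne'] at h
      rw [one_smul, h]
    refine ⟨(if d = n then Q⁻¹ else 1) * (if b = p then Q else 1), fun h => absurd h hdb,
      fun v hv => ?_⟩
    have h := hz.apply n b p d v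
    rw [hrow' hbn v hv] at h
    rcases eq_or_ne b p with rfl | hbp
    · rw [hU.partialProd_eq_zero (by omega) le_rfl (by omega) (by omega) hv] at h
      rcases eq_or_ne d n with rfl | hdn
      · rw [hF _ _ le_rfl (by omega) (by omega) v hv] at h
        simp [hbn.ne, hbn.ne', hbn.not_gt] at h
        rw [if_pos rfl, if_pos rfl, inv_mul_cancel₀ hQ, one_smul]
        exact (smul_right_injective W hQ h).symm
      · simp [hbn.ne', hbn.not_gt, hpd.ne, hpd.ne', hdn, hdn.symm] at h
        simp [hdn, h]
    · rcases eq_or_ne d n with rfl | hdn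
      · rw [hF _ _ le_rfl (by omega) (by omega) v hv] at h
        simp [hbn.ne, hbn.ne', hbn.not_gt, hpd.ne, hbp, hbp.symm] at h
        simp [hbp, h, hQ]
      · simp [hbn.ne', hbn.not_gt, hpd.ne, hdn, hdn.symm, hdb, hdb.symm,
          hbp, hbp.symm] at h
        simp [hdn, hbp, h]
  · rcases eq_or_ne d p with rfl | hdp
    · exact ⟨1, fun _ => rfl, fun v _ => by rw [one_smul]⟩
    have hpd : p < d := by omega
    rcases eq_or_ne d b with rfl | hdb
    · refine ⟨1, fun _ => rfl, fun v hv => ?_⟩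
      have h := hz.apply d d p d v
      rw [hF _ _ le_rfl (by omega) (by omega) v hv] at h
      simp [hpd, hpd.ne, hpd.ne'] at h
      linear_combination (norm := skip) -h
      match_scalars <;> field_simp <;> ring
    · refine ⟨Q, fun h => absurd h hdb, fun v hv => ?_⟩
      have h := hz.apply b b p d v
      simp [hpd, hpd.ne, hpn.ne, hpn.ne', hdb, hdb.symm] at h
      linear_combination (norm := skip) (-Q) • h
      match_scalars <;> field_simp <;> ring
  · rcases eq_or_ne d p with rfl | hdp
    · refine ⟨Q⁻¹, fun h => absurd h (hpn.trans hbn).ne, fun v hv => ?_⟩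
      rw [hz.row_comm (by omega) hpn hbn hb.2, smul_smul, inv_mul_cancel₀ hQ, one_smul]
    have hpd : p < d := by omega
    refine ⟨if d = n then Q⁻¹ else 1, ?_, fun v hv => ?_⟩
    · rintro rfl
      rw [if_neg hbn.ne']
    have h := hz.apply n b p d v
    rcases eq_or_ne d n with rfl | hdn
    · rw [hF _ _ le_rfl (by omega) (by omega) v hv] at h
      simp [hbn, hbn.ne, hbn.ne', hpd, hpd.ne, (hpd.trans hbn).ne,
        (hpd.trans hbn).ne'] at h
      simp [h, hQ]
    · simp [hpd, hpd.ne, hbn, hbn.ne, (hpn.trans hbn).ne,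
        (hpn.trans hbn).ne', hdn, hdn.symm] at h
      simp [hdn, h]

end SupportedFrom

theorem exists_apply_eq_zero_of_isNilpotent {A : Module.End ℂ W} (hA : IsNilpotent A)
    {P : W → Prop} (hP : ∀ w, P w → A w ≠ 0 → P (A w)) {w : W} (hw : P w) (hw0 : w ≠ 0) :
    ∃ w', P w' ∧ w' ≠ 0 ∧ A w' = 0 := by
  obtain ⟨n, hn⟩ := hA
  have hnw : (A ^ n) w = 0 := by rw [hn, LinearMap.zero_apply]
  clear hn
  induction n generalizing w with
  | zero => exact absurd (by simpa using hnw) hw0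
  | succ n ih =>
    by_cases h : A w = 0
    · exact ⟨w, hw, hw0, h⟩
    · exact ih (hP w hw h) h (by rwa [pow_succ, Module.End.mul_apply] at hnw)

/-- Pairwise `q`-commuting nilpotent operators have a common null vector. -/
theorem exists_forall_apply_eq_zero {ι : Type*} (S : Finset ι) (A : ι → Module.End ℂ W)
    (hA : ∀ i ∈ S, IsNilpotent (A i))
    (hcomm : ∀ i ∈ S, ∀ j ∈ S, ∃ κ : ℂ, ∀ w, A i (A j w) = κ • A j (A i w))
    {P : W → Prop} (hP : ∀ i ∈ S, ∀ w, P w → A i w ≠ 0 → P (A i w)) {w : W} (hw : P w)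
    (hw0 : w ≠ 0) : ∃ w', P w' ∧ w' ≠ 0 ∧ ∀ i ∈ S, A i w' = 0 := by
  classical
  induction S using Finset.induction_on with
  | empty => exact ⟨w, hw, hw0, by simp⟩
  | insert a S _ ih =>
    obtain ⟨w₁, hw₁, hw₁0, hS⟩ := ih (fun i hi => hA i (mem_insert_of_mem hi))
      (fun i hi j hj => hcomm i (mem_insert_of_mem hi) j (mem_insert_of_mem hj))
      (fun i hi => hP i (mem_insert_of_mem hi))
    obtain ⟨w₂, ⟨hw₂, hS₂⟩, hw₂0, ha⟩ := exists_apply_eq_zero_of_isNilpotent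
      (hA a (mem_insert_self _ _)) (P := fun w => P w ∧ ∀ i ∈ S, A i w = 0)
      (fun w hw h => ⟨hP a (mem_insert_self _ _) w hw.1 h, fun i hi => by
        obtain ⟨κ, hκ⟩ := hcomm i (mem_insert_of_mem hi) a (mem_insert_self _ _)
        rw [hκ, hw.2 i hi, map_zero, smul_zero]⟩) ⟨hw₁, hS⟩ hw₁0
    refine ⟨w₂, hw₂, hw₂0, fun i hi => ?_⟩
    rcases mem_insert.1 hi with rfl | hi
    · exact ha
    · exact hS₂ i hi

/-- Commuting operators have a common eigenvector in a nonzero invariant subspace. -/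
theorem exists_common_eigenvector [FiniteDimensional ℂ W] {ι : Type*} (S : Finset ι)
    (A : ι → Module.End ℂ W) (hcomm : ∀ i ∈ S, ∀ j ∈ S, ∀ w, A i (A j w) = A j (A i w))
    (E : Submodule ℂ W) (hE : E ≠ ⊥) (hinv : ∀ i ∈ S, ∀ w ∈ E, A i w ∈ E) :
    ∃ v ∈ E, v ≠ 0 ∧ ∀ i ∈ S, ∃ c : ℂ, A i v = c • v := by
  classical
  induction S using Finset.induction_on generalizing E with
  | empty =>
    obtain ⟨v, hv, hv0⟩ := Submodule.exists_mem_ne_zero_of_ne_bot hE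
    exact ⟨v, hv, hv0, by simp⟩
  | insert a S _ ih =>
    have : Nontrivial E := Submodule.nontrivial_iff_ne_bot.2 hE
    obtain ⟨μ, hμ⟩ := Module.End.exists_eigenvalue
      ((A a).restrict (hinv a (mem_insert_self _ _)))
    obtain ⟨⟨u, huE⟩, hu⟩ := hμ.exists_hasEigenvector
    have hu1 : A a u = μ • u := congrArg Subtype.val hu.apply_eq_smul
    have hu0 : u ≠ 0 := fun h => hu.2 (Subtype.ext h)
    obtain ⟨v, hv, hv0, hS⟩ := ih
      (fun i hi j hj => hcomm i (mem_insert_of_mem hi) j (mem_insert_of_mem hj))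
      (E ⊓ Module.End.eigenspace (A a) μ)
      (Submodule.ne_bot_iff _ |>.2 ⟨u, ⟨huE, Module.End.mem_eigenspace_iff.2 hu1⟩, hu0⟩)
      (fun i hi w hw => ⟨hinv i (mem_insert_of_mem hi) w hw.1, Module.End.mem_eigenspace_iff.2 (by
        rw [hcomm a (mem_insert_self _ _) i (mem_insert_of_mem hi),
          Module.End.mem_eigenspace_iff.1 hw.2, map_smul])⟩)
    refine ⟨v, hv.1, hv0, fun i hi => ?_⟩
    rcases mem_insert.1 hi with rfl | hi
    · exact ⟨μ, Module.End.mem_eigenspace_iff.1 hv.2⟩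
    · exact hS i hi

/-- The operators through which the quantum Grassmannian acts on a representation where the
off-diagonal generators are nilpotent. -/
structure NilpotentGrassRep (Q : ℂ) (N s : ℕ) (z : ℕ → ℕ → Module.End ℂ W) : Prop where
  ne_zero : Q ≠ 0
  zpow_injective : Function.Injective fun n : ℤ => Q ^ n
  reflectionRel : ReflectionRel Q N z
  trace : ∀ v, (Q - Q⁻¹) • ∑ i ∈ Icc 1 N, z i i v = (1 - (Q ^ (2 * s))⁻¹) • v
  projector : ∀ i k, 1 ≤ i ∧ i ≤ N → 1 ≤ k ∧ k ≤ N → ∀ v,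
    partialProd Q z (N + 1) i k v = (Q ^ (2 * N + 1))⁻¹ • z i k v
  isNilpotent : ∀ i j, 1 ≤ i ∧ i ≤ N → 1 ≤ j ∧ j ≤ N → i ≠ j → IsNilpotent (z i j)

/-- `v` is annihilated by the entries below the diagonal in the columns before the `j`-th. -/
def KilledBelow (N : ℕ) (z : ℕ → ℕ → Module.End ℂ W) (j : ℕ) (v : W) : Prop :=
  ∀ k n, 1 ≤ k → k < j → k < n → n ≤ N → z n k v = 0

theorem KilledBelow.mono {i j : ℕ} {v : W} (h : KilledBelow N z j v) (hij : i ≤ j) :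
    KilledBelow N z i v :=
  fun k n hk hki => h k n hk (hki.trans_le hij)

namespace NilpotentGrassRep

variable (R : NilpotentGrassRep Q N s z)
include R

theorem sq_ne_one : Q ^ 2 ≠ 1 := fun h => by
  have : (2 : ℤ) = 0 := R.zpow_injective (by simpa [zpow_ofNat] using h)
  omega

theorem apply_apply_eq_zero {j d : ℕ} (hjd : j < d) (hd : d ≤ N) {v : W}
    (hv : KilledBelow N z (j + 1) v) {k : ℕ} (hk : 1 ≤ k) (hkj : k ≤ j) :
    z d k (z k j v) = 0 := by
  induction k using Nat.strong_induction_on with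
  | _ k ih =>
    have h := R.reflectionRel.apply j k k d v
    rw [partialProd_apply_eq_zero (fun l hl hlk => ih l hlk hl (by omega)),
      hv j d (by omega) (by omega) hjd hd, hv k d hk (by omega) (by omega) hd] at h
    have hkd : k < d := by omega
    simpa [hkd.ne, hkd.ne', hjd.ne, hjd.ne', hkj.not_gt, R.ne_zero] using h

theorem partialProd_column_eq_zero {j d b : ℕ} (hj : 1 ≤ j) (hjd : j < d) (hd : d ≤ N)
    (hb : b ≤ N + 1) {v : W} (hv : KilledBelow N z (j + 1) v) :
    partialProd Q z b d j v = 0 := by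
  refine partialProd_apply_eq_zero fun k hk hkb => ?_
  rcases le_or_gt k j with h | h
  · exact R.apply_apply_eq_zero hjd hd hv hk h
  · rw [hv j k hj (by omega) h (by omega), map_zero]

theorem column_apply_eq_zero {k n d b : ℕ} (hk : 1 ≤ k) (hkn : k < n) (hn : n ≤ N)
    (hkd : k < d) (hd : d ≤ N) (hkb : k < b) (hb : b ≤ N) {v : W}
    (hv : KilledBelow N z (k + 1) v) : z n k (z d b v) = 0 := by
  have h := R.reflectionRel.apply k b n d v
  rw [R.partialProd_column_eq_zero hk hkd hd (by omega) hv,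
    R.partialProd_column_eq_zero hk hkn hn (by omega) hv,
    hv k n hk (by omega) hkn hn, hv k d hk (by omega) hkd hd] at h
  simpa [hkd.ne, hkd.ne', hkb.ne, eq_comm] using h

theorem killedBelow_diag {j i : ℕ} (hi : 1 ≤ i ∧ i ≤ N) {v : W} (hv : KilledBelow N z j v) :
    KilledBelow N z j (z i i v) := by
  intro k n hk hkj hkn hn
  rcases lt_trichotomy k i with hki | rfl | hki
  · exact R.column_apply_eq_zero hk hkn hn hki hi.2 hki hi.2 (hv.mono hkj)
  · have h := R.reflectionRel.apply k k n k v
    rw [R.partialProd_column_eq_zero hk hkn hn (by omega) (hv.mono hkj),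
      hv k n hk hkj hkn hn] at h
    have hQ := R.ne_zero
    simp [hkn.ne, hkn.not_gt] at h
    simpa [hQ] using h.symm
  · have h := R.reflectionRel.apply k i n i v
    rw [hv k n hk hkj hkn hn] at h
    simpa [hki.ne, hki.ne', hki.not_gt, (hki.trans hkn).ne, (hki.trans hkn).not_gt,
      eq_comm] using h

theorem column_isNilpotent {j n : ℕ} (hj : 1 ≤ j) (hn : n ∈ Ioc j N) : IsNilpotent (z n j) := by
  rw [mem_Ioc] at hn
  exact R.isNilpotent n j (by omega) (by omega) (by omega)

theorem row_isNilpotent {j n : ℕ} (hj : 1 ≤ j) (hn : n ∈ Ioc j N) : IsNilpotent (z j n) := by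
  rw [mem_Ioc] at hn
  exact R.isNilpotent j n (by omega) (by omega) (by omega)

theorem exists_column_comm {j m n : ℕ} (hj : 1 ≤ j) (hm : m ∈ Ioc j N) (hn : n ∈ Ioc j N) :
    ∃ κ : ℂ, ∀ w, z m j (z n j w) = κ • z n j (z m j w) := by
  rw [mem_Ioc] at hm hn
  rcases lt_trichotomy m n with h | rfl | h
  · refine ⟨Q, fun w => ?_⟩
    rw [R.reflectionRel.column_comm R.ne_zero hj hm.1 h hn.2, smul_smul,
      mul_inv_cancel₀ R.ne_zero, one_smul]
  · exact ⟨1, fun w => by rw [one_smul]⟩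
  · exact ⟨Q⁻¹, R.reflectionRel.column_comm R.ne_zero hj hn.1 h hm.2⟩

theorem exists_row_comm {j m n : ℕ} (hj : 1 ≤ j) (hm : m ∈ Ioc j N) (hn : n ∈ Ioc j N) :
    ∃ κ : ℂ, ∀ w, z j m (z j n w) = κ • z j n (z j m w) := by
  rw [mem_Ioc] at hm hn
  rcases lt_trichotomy m n with h | rfl | h
  · refine ⟨Q⁻¹, fun w => ?_⟩
    rw [R.reflectionRel.row_comm hj hm.1 h hn.2, smul_smul,
      inv_mul_cancel₀ R.ne_zero, one_smul]
  · exact ⟨1, fun w => by rw [one_smul]⟩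
  · exact ⟨Q, R.reflectionRel.row_comm hj hn.1 h hm.2⟩

theorem exists_killedBelow {U : Submodule ℂ W} (hU : SupportedFrom N z p U) (hU0 : U ≠ ⊥) {j : ℕ}
    (hj : 1 ≤ j) (hjN : j ≤ N + 1) : ∃ w ∈ U, w ≠ 0 ∧ KilledBelow N z j w := by
  induction j, hj using Nat.le_induction with
  | base =>
    obtain ⟨v, hv, hv0⟩ := Submodule.exists_mem_ne_zero_of_ne_bot hU0
    exact ⟨v, hv, hv0, fun k n h1 h2 => by omega⟩
  | succ j hj ih =>
    obtain ⟨w, hw, hw0, hk⟩ := ih (by omega)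
    obtain ⟨w', ⟨hw', hk'⟩, hw0', hz⟩ := exists_forall_apply_eq_zero (Ioc j N) (fun n => z n j)
      (fun n hn => R.column_isNilpotent hj hn)
      (fun m hm n hn => R.exists_column_comm hj hm hn)
      (P := fun w => w ∈ U ∧ KilledBelow N z j w)
      (fun n hn w hw _ => by
        rw [mem_Ioc] at hn
        exact ⟨hU.mapsTo n j (by omega) (by omega) w hw.1, fun k m hk hkj hkm hm =>
          R.column_apply_eq_zero hk hkm hm (by omega) (by omega) hkj (by omega)
            (hw.2.mono hkj)⟩) ⟨hw, hk⟩ hw0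
    refine ⟨w', hw', hw0', fun k n h1 hkj hkn hn => ?_⟩
    rcases Nat.lt_succ_iff_lt_or_eq.1 hkj with h | rfl
    · exact hk' k n h1 h hkn hn
    · exact hz n (mem_Ioc.2 ⟨hkn, hn⟩)

/-- Every nonzero subspace as above contains a highest weight vector. -/
theorem exists_highest [FiniteDimensional ℂ W] {U : Submodule ℂ W} (hU : SupportedFrom N z p U)
    (hU0 : U ≠ ⊥) : ∃ w ∈ U, w ≠ 0 ∧ KilledBelow N z (N + 1) w ∧
      ∀ i, 1 ≤ i ∧ i ≤ N → ∃ c : ℂ, z i i w = c • w := by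
  obtain ⟨w, hw, hw0, hk⟩ := R.exists_killedBelow hU hU0 (Nat.le_add_left 1 N) le_rfl
  let K : Submodule ℂ W :=
    { carrier := {v | v ∈ U ∧ KilledBelow N z (N + 1) v}
      add_mem' := fun ha hb => ⟨U.add_mem ha.1 hb.1, fun k n h1 h2 h3 h4 => by
        rw [map_add, ha.2 k n h1 h2 h3 h4, hb.2 k n h1 h2 h3 h4, add_zero]⟩
      zero_mem' := ⟨U.zero_mem, fun _ _ _ _ _ _ => map_zero _⟩
      smul_mem' := fun c v hv => ⟨U.smul_mem c hv.1, fun k n h1 h2 h3 h4 => by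
        rw [map_smul, hv.2 k n h1 h2 h3 h4, smul_zero]⟩ }
  obtain ⟨v, hv, hv0, hc⟩ := exists_common_eigenvector (Icc 1 N) (fun i => z i i)
    (fun i hi j hj w => R.reflectionRel.diag_comm (mem_Icc.1 hi) (mem_Icc.1 hj) w) K
    (Submodule.ne_bot_iff _ |>.2 ⟨w, ⟨hw, hk⟩, hw0⟩)
    (fun i hi v hv => ⟨hU.mapsTo i i (mem_Icc.1 hi) (mem_Icc.1 hi) v hv.1,
      R.killedBelow_diag (mem_Icc.1 hi) hv.2⟩)
  exact ⟨v, hv.1, hv0, hv.2, fun i hi => hc i (mem_Icc.2 hi)⟩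

theorem highest_weight_eq {v : W} (hv0 : v ≠ 0) (hv : KilledBelow N z (N + 1) v) {c : ℕ → ℂ}
    (hc : ∀ i, 1 ≤ i ∧ i ≤ N → z i i v = c i • v) {i : ℕ} (hi : 1 ≤ i ∧ i ≤ N) :
    c i = Q ^ (2 * i) * (Q ^ (2 * N + 1))⁻¹ ∨ c i = (Q ^ 2 - 1) * ∑ k ∈ Ico 1 i, c k := by
  have hQ := R.ne_zero
  have hdiag : ∀ j n, 1 ≤ j → j < n → n ≤ N + 1 →
      partialProd Q z n j j v = ((Q ^ (2 * N + 1))⁻¹ * c j) • v := by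
    intro j n hj hjn hn
    have h0 : ∀ k, j + 1 ≤ k → k < N + 1 → z j k (z k j v) = 0 := fun k hk hkN => by
      rw [hv j k hj (by omega) (by omega) (by omega), map_zero]
    rw [partialProd_apply_eq_of_le (by omega) hjn fun k hk hkn => h0 k hk (by omega),
      ← partialProd_apply_eq_of_le (by omega) (hjn.trans_le hn) h0, R.projector j j (by omega)
      (by omega), hc j (by omega), smul_smul]
  have key : ∀ j, 1 ≤ j → j ≤ i → Q ^ (2 * j) • partialProd Q z j i i v =
      ((Q ^ 2 - 1) * (Q ^ (2 * i) * (Q ^ (2 * N + 1))⁻¹ - c i) * ∑ k ∈ Ico 1 j, c k) • v := by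
    intro j hj
    induction j, hj using Nat.le_induction with
    | base =>
      intro _
      rw [partialProd_apply_eq_zero (by omega)]
      simp
    | succ j hj ih =>
      intro hji
      have ih := ih (by omega)
      have h := R.reflectionRel.apply i j j i v
      rw [hv j i hj (by omega) (by omega) hi.2, hdiag j i hj hji (by omega), hc i hi, map_smul,
        hc j (by omega)] at h
      have hji' : j < i := hji
      simp [hji', hji'.ne, hji'.ne', hji'.not_gt] at h
      rw [partialProd_succ_apply hj, sum_Ico_succ_top hj]
      linear_combination (norm := skip) ih + Q • h
      match_scalars <;> field_simp <;> ring
  have h1 := key i hi.1 le_rfl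
  have h2 := hdiag i (i + 1) hi.1 (by omega) (by omega)
  rw [partialProd_succ_apply hi.1, hc i hi, map_smul, hc i hi] at h2
  have h3 : ((Q ^ (2 * i) * (Q ^ (2 * N + 1))⁻¹ - c i) *
      (c i - (Q ^ 2 - 1) * ∑ k ∈ Ico 1 i, c k)) • v = 0 := by
    linear_combination (norm := skip) h1 - Q ^ (2 * i) • h2
    match_scalars <;> field_simp <;> ring
  rcases mul_eq_zero.1 ((smul_eq_zero.1 h3).resolve_right hv0) with h | h
  · exact Or.inl (sub_eq_zero.1 h).symm
  · exact Or.inr (sub_eq_zero.1 h)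

end NilpotentGrassRep

namespace NilpotentGrassRep

variable (R : NilpotentGrassRep Q N s z)
include R

/-- A nonzero subrepresentation supported in `[p, N]` needs `s` available indices. -/
theorem add_le_of_supportedFrom [FiniteDimensional ℂ W] (hs : 1 ≤ s) {U : Submodule ℂ W}
    (hU : SupportedFrom N z p U) (hU0 : U ≠ ⊥) : s + p ≤ N + 1 := by
  have hQ := R.ne_zero
  obtain ⟨w, hw, hw0, hk, hc⟩ := R.exists_highest hU hU0
  choose! c hc using hc
  have key : ∀ i, i ≤ N → ∃ m : ℕ, (m = 0 ∨ m + p ≤ i + 1) ∧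
      Q ^ (2 * N) * Q ^ (2 * m) * (Q - Q⁻¹) * ∑ k ∈ Ico 1 (i + 1), c k =
        Q ^ (2 * i) * (Q ^ (2 * m) - 1) := by
    intro i
    induction i with
    | zero => exact fun _ => ⟨0, Or.inl rfl, by simp⟩
    | succ i ih =>
      intro hi
      obtain ⟨m, hm, h⟩ := ih (by omega)
      rw [sum_Ico_succ_top (by omega)]
      by_cases hip : i + 1 < p
      · have hm0 : m = 0 := by omega
        subst hm0
        have hci : c (i + 1) = 0 := by
          have h1 := hc (i + 1) (by omega)
          rw [hU.eq_zero _ _ (by omega) (by omega) (Or.inl hip) w hw] at h1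
          exact (smul_eq_zero.1 h1.symm).resolve_right hw0
        exact ⟨0, Or.inl rfl, by rw [hci, add_zero, h]; simp⟩
      rcases R.highest_weight_eq hw0 hk hc (i := i + 1) (by omega) with h1 | h1
      · refine ⟨m + 1, Or.inr (by omega), ?_⟩
        rw [h1]
        linear_combination (norm := skip) Q ^ 2 * h
        field_simp
        ring
      · refine ⟨m, by omega, ?_⟩
        rw [h1]
        linear_combination Q ^ 2 * h
  obtain ⟨m, hm, h⟩ := key N le_rfl
  have ht := R.trace w
  have hI : Ico 1 (N + 1) = Icc 1 N := by
    ext x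
    simp only [mem_Ico, mem_Icc]
    omega
  rw [sum_congr rfl fun i hi => hc i (mem_Icc.1 hi), ← sum_smul, smul_smul] at ht
  have ht := smul_left_injective ℂ hw0 ht
  rw [hI] at h
  have h2 : Q ^ (2 * (m : ℤ)) = Q ^ (2 * (s : ℤ)) := by
    have : Q ^ (2 * m) = Q ^ (2 * s) := by
      have h3 : Q ^ (2 * m) * (1 - (Q ^ (2 * s))⁻¹) = Q ^ (2 * m) - 1 := by
        refine mul_left_cancel₀ (pow_ne_zero (2 * N) hQ) ?_
        linear_combination h - Q ^ (2 * N) * Q ^ (2 * m) * ht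
      field_simp at h3
      linear_combination -h3
    exact_mod_cast this
  have := R.zpow_injective h2
  omega

theorem exists_corner_eigenvalue_mul_eq {U : Submodule ℂ W} (hU : SupportedFrom N z p U)
    (hp : 1 ≤ p ∧ p ≤ N) {w : W} (hw : w ∈ U) (hw0 : w ≠ 0) {c : ℂ} (hc : z p p w = c • w)
    (hc0 : c ≠ 0) : ∃ k : ℕ, c * Q ^ (2 * k) = Q ^ (2 * p) * (Q ^ (2 * N + 1))⁻¹ := by
  have hQ := R.ne_zero
  obtain ⟨u, ⟨hu, k, hk⟩, hu0, hz⟩ := exists_forall_apply_eq_zero (Ioc p N) (fun n => z n p)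
    (fun n hn => R.column_isNilpotent hp.1 hn)
    (fun m hm n hn => R.exists_column_comm hp.1 hm hn)
    (P := fun w => w ∈ U ∧ ∃ k : ℕ, z p p w = (c * Q ^ (2 * k)) • w)
    (fun n hn w ⟨hw, k, hk⟩ _ => by
      rw [mem_Ioc] at hn
      refine ⟨hU.mapsTo n p (by omega) hp w hw, k + 1, ?_⟩
      rw [hU.corner_column R.reflectionRel hQ hp.1 hn.1 hn.2 hw, hk, map_smul, smul_smul]
      congr 1
      ring) ⟨hw, 0, by simpa using hc⟩ hw0
  refine ⟨k, ?_⟩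
  have h := R.projector p p hp hp u
  rw [partialProd_apply_eq_of_le (b := p + 1) (by omega) (by omega) fun n hn hnN => by
      rw [hz n (mem_Ioc.2 ⟨hn, by omega⟩), map_zero],
    partialProd_succ_apply hp.1, hU.partialProd_eq_zero hp.2 le_rfl hp hp hu, zero_add, hk,
    map_smul, hk, smul_smul, smul_smul, smul_smul] at h
  have h := smul_left_injective ℂ hu0 h
  refine mul_left_cancel₀ (mul_ne_zero hc0 (pow_ne_zero (2 * k) hQ)) ?_
  linear_combination (norm := skip) Q ^ (2 * p) * h
  field_simp
  ring

theorem corner_eigenvalue_mul_eq_of_row {U : Submodule ℂ W} (hU : SupportedFrom N z p U)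
    (hp : 1 ≤ p ∧ p ≤ N) {w : W} (hw : w ∈ U) (hw0 : w ≠ 0) {c : ℂ} (hc : z p p w = c • w)
    (hc0 : c ≠ 0) (hrow : ∀ n, p < n → n ≤ N → z p n w = 0) : c * Q ^ (2 * s) = Q := by
  have hQ := R.ne_zero
  have key : ∀ n, p + 1 ≤ n → n ≤ N + 1 → Q ^ (2 * n) • partialProd Q z n p p w =
      (Q ^ 2 * c ^ 2) • w + ((Q ^ 2 - 1) * c) • ∑ k ∈ Ico (p + 1) n, z k k w := by
    intro n hn
    induction n, hn using Nat.le_induction with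
    | base =>
      intro _
      rw [partialProd_succ_apply hp.1, hU.partialProd_eq_zero hp.2 le_rfl hp hp hw, hc, map_smul,
        hc, Ico_self, sum_empty]
      match_scalars
      field_simp
      ring
    | succ n hn ih =>
      intro hnN
      have ih := ih (by omega)
      have hpn : p < n := hn
      have h := hU.column_row R.reflectionRel hp.1 hpn (by omega) hpn (by omega) hw
      rw [hrow n hpn (by omega), R.reflectionRel.diag_comm hp (by omega), hc, map_smul] at h
      simp only [map_zero, smul_zero, zero_add, if_true] at h
      rw [partialProd_succ_apply (by omega), sum_Ico_succ_top hn]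
      linear_combination (norm := skip) ih - Q • h
      match_scalars <;> field_simp <;> ring
  have h1 := key (N + 1) (by omega) le_rfl
  have h2 := R.trace w
  have hI : Icc 1 N = Ico 1 (N + 1) := by
    ext x
    simp only [mem_Ico, mem_Icc]
    omega
  rw [hI, ← sum_Ico_consecutive _ hp.1 (by omega : p ≤ N + 1), sum_eq_zero fun k hk => by
      rw [mem_Ico] at hk
      exact hU.eq_zero k k (by omega) (by omega) (by omega) w hw,
    zero_add, sum_eq_sum_Ico_succ_bot (by omega : p < N + 1), hc] at h2
  rw [R.projector p p hp hp, hc] at h1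
  have h3 : (c * (c * Q ^ (2 * s) - Q)) • w = 0 := by
    linear_combination (norm := skip) -Q ^ (2 * s) • h1 - (Q ^ (2 * s) * Q * c) • h2
    match_scalars <;> field_simp <;> ring
  exact sub_eq_zero.1 ((mul_eq_zero.1 ((smul_eq_zero.1 h3).resolve_right hw0)).resolve_left hc0)

theorem exists_corner_eigenvalue_eq {U : Submodule ℂ W} (hU : SupportedFrom N z p U)
    (hp : 1 ≤ p ∧ p ≤ N) {w : W} (hw : w ∈ U) (hw0 : w ≠ 0) {c : ℂ} (hc : z p p w = c • w)
    (hc0 : c ≠ 0) : ∃ m : ℕ, c * Q ^ (2 * s) = Q * Q ^ (2 * m) := by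
  have hQ := R.ne_zero
  obtain ⟨u, ⟨hu, m, hm⟩, hu0, hz⟩ := exists_forall_apply_eq_zero (Ioc p N) (fun n => z p n)
    (fun n hn => R.row_isNilpotent hp.1 hn)
    (fun m hm n hn => R.exists_row_comm hp.1 hm hn)
    (P := fun w => w ∈ U ∧ ∃ m : ℕ, z p p w = (c * (Q ^ (2 * m))⁻¹) • w)
    (fun n hn w ⟨hw, m, hm⟩ _ => by
      rw [mem_Ioc] at hn
      refine ⟨hU.mapsTo p n hp (by omega) w hw, m + 1, ?_⟩
      have h := hU.corner_row R.reflectionRel hQ hp.1 hn.1 hn.2 hw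
      rw [hm, map_smul] at h
      linear_combination (norm := skip) -(Q ^ 2)⁻¹ • h
      match_scalars <;> field_simp <;> ring) ⟨hw, 0, by simpa using hc⟩ hw0
  refine ⟨m, ?_⟩
  have h := R.corner_eigenvalue_mul_eq_of_row hU hp hu hu0 hm
    (mul_ne_zero hc0 (inv_ne_zero (pow_ne_zero _ hQ)))
    fun n hn hnN => hz n (mem_Ioc.2 ⟨hn, hnN⟩)
  field_simp at h
  linear_combination h

theorem corner_eigenvalue_eq [FiniteDimensional ℂ W] (hs : 1 ≤ s) {U : Submodule ℂ W}
    (hU : SupportedFrom N z p U) (hp : 1 ≤ p ∧ p ≤ N) {w : W} (hw : w ∈ U) (hw0 : w ≠ 0) {c : ℂ}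
    (hc : z p p w = c • w) (hc0 : c ≠ 0) :
    s + p = N + 1 ∧ c = Q ^ (2 * p) * (Q ^ (2 * N + 1))⁻¹ := by
  have hQ := R.ne_zero
  obtain ⟨k, hk⟩ := R.exists_corner_eigenvalue_mul_eq hU hp hw hw0 hc hc0
  obtain ⟨m, hm⟩ := R.exists_corner_eigenvalue_eq hU hp hw hw0 hc hc0
  have hle := R.add_le_of_supportedFrom hs hU (Submodule.ne_bot_iff _ |>.2 ⟨w, hw, hw0⟩)
  have h : Q ^ ((2 * m + 2 * k + 2 * N + 2 : ℕ) : ℤ) = Q ^ ((2 * p + 2 * s : ℕ) : ℤ) := by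
    rw [zpow_natCast, zpow_natCast]
    field_simp at hk
    linear_combination (norm := ring) Q ^ (2 * s) * hk - Q ^ (2 * k + 2 * N + 1) * hm
  have := R.zpow_injective h
  obtain rfl : k = 0 := by omega
  exact ⟨by omega, by simpa using hk⟩

end NilpotentGrassRep

theorem SupportedFrom.inf_ker {U : Submodule ℂ W} (hU : SupportedFrom N z p U)
    {X : Module.End ℂ W} (hX : ∀ d b, 1 ≤ d ∧ d ≤ N → 1 ≤ b ∧ b ≤ N →
      ∀ v ∈ U, X v = 0 → X (z d b v) = 0) : SupportedFrom N z p (U ⊓ LinearMap.ker X) where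
  mapsTo i j hi hj v hv := ⟨hU.mapsTo i j hi hj v hv.1, hX i j hi hj v hv.1 hv.2⟩
  eq_zero i j hi hj hij v hv := hU.eq_zero i j hi hj hij v hv.1

/-- `U` contains a common eigenvector of the diagonal operators, with eigenvalues `c`. -/
def HasWeight (N : ℕ) (z : ℕ → ℕ → Module.End ℂ W) (c : ℕ → ℂ) (U : Submodule ℂ W) : Prop :=
  ∃ v ∈ U, v ≠ 0 ∧ ∀ i, 1 ≤ i ∧ i ≤ N → z i i v = c i • v

theorem HasWeight.inf_ker {c : ℕ → ℂ} {U : Submodule ℂ W} (hc : HasWeight N z c U)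
    {X : Module.End ℂ W} (hX : IsNilpotent X) (hXU : ∀ v ∈ U, X v ∈ U)
    (hcomm : ∀ i, 1 ≤ i ∧ i ≤ N → ∀ v ∈ U, X (z i i v) = z i i (X v)) :
    HasWeight N z c (U ⊓ LinearMap.ker X) := by
  obtain ⟨v, hv, hv0, hvc⟩ := hc
  obtain ⟨u, ⟨hu, huc⟩, hu0, hXu⟩ := exists_apply_eq_zero_of_isNilpotent hX
    (P := fun w => w ∈ U ∧ ∀ i, 1 ≤ i ∧ i ≤ N → z i i w = c i • w)
    (fun w hw _ => ⟨hXU w hw.1, fun i hi => by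
      rw [← hcomm i hi w hw.1, hw.2 i hi, map_smul]⟩) ⟨hv, hvc⟩ hv0
  exact ⟨u, ⟨hu, hXu⟩, hu0, huc⟩

/-- The kernel of a nilpotent operator normalising the generators carries the same structure. -/
theorem SupportedFrom.inf_ker_of_normal {c : ℕ → ℂ} {U : Submodule ℂ W}
    (hU : SupportedFrom N z p U) (hc : HasWeight N z c U) {X : Module.End ℂ W}
    (hX : IsNilpotent X) (hXU : ∀ v ∈ U, X v ∈ U)
    (hnorm : ∀ d b, 1 ≤ d ∧ d ≤ N → 1 ≤ b ∧ b ≤ N →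
      ∃ κ : ℂ, (d = b → κ = 1) ∧ ∀ v ∈ U, X (z d b v) = κ • z d b (X v)) :
    SupportedFrom N z p (U ⊓ LinearMap.ker X) ∧ HasWeight N z c (U ⊓ LinearMap.ker X) := by
  refine ⟨hU.inf_ker fun d b hd hb v hv h0 => ?_, hc.inf_ker hX hXU fun i hi v hv => ?_⟩
  · obtain ⟨κ, -, hκ⟩ := hnorm d b hd hb
    rw [hκ v hv, h0, map_zero, smul_zero]
  · obtain ⟨κ, hκ1, hκ⟩ := hnorm i i hi hi
    rw [hκ v hv, hκ1 rfl, one_smul]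

namespace NilpotentGrassRep

variable (R : NilpotentGrassRep Q N s z)
include R

/-- If the corner operator has a null weight vector, the support can be shrunk. -/
theorem exists_supportedFrom_succ {U : Submodule ℂ W} (hU : SupportedFrom N z p U)
    (hp : 1 ≤ p ∧ p ≤ N) {c : ℕ → ℂ} (hc : HasWeight N z c U) (hcp : c p = 0) :
    ∃ U', SupportedFrom N z (p + 1) U' ∧ HasWeight N z c U' := by
  have hQ := R.ne_zero
  have hz := R.reflectionRel
  have corner : ∃ U', SupportedFrom N z p U' ∧ HasWeight N z c U' ∧
      ∀ v ∈ U', z p p v = 0 := by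
    refine ⟨U ⊓ LinearMap.ker (z p p), hU.inf_ker fun d b hd hb v hv h0 => ?_, ?_,
      fun v hv => hv.2⟩
    · by_cases hlow : d < p ∨ b < p
      · rw [hU.eq_zero d b hd hb hlow v hv, map_zero]
      rcases eq_or_lt_of_le (not_lt.1 fun h => hlow (Or.inl h)) with rfl | hd'
      · rcases eq_or_lt_of_le (not_lt.1 fun h => hlow (Or.inr h)) with rfl | hb'
        · rw [h0, map_zero]
        · have h := hU.corner_row hz hQ hp.1 hb' hb.2 hv
          rw [h0, map_zero] at h
          exact (smul_eq_zero.1 h.symm).resolve_left (pow_ne_zero 2 hQ)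
      · rcases eq_or_lt_of_le (not_lt.1 fun h => hlow (Or.inr h)) with rfl | hb'
        · rw [hU.corner_column hz hQ hp.1 hd' hd.2 hv, h0, map_zero, smul_zero]
        · rw [SupportedFrom.corner_comm hz hp.1 hd' hd.2 hb' hb.2, h0, map_zero]
    · obtain ⟨v, hv, hv0, hvc⟩ := hc
      exact ⟨v, ⟨hv, LinearMap.mem_ker.2 (by rw [hvc p hp, hcp, zero_smul])⟩, hv0, hvc⟩
  have columns : ∀ n, p + 1 ≤ n → n ≤ N + 1 → ∃ U', SupportedFrom N z p U' ∧
      HasWeight N z c U' ∧ ∀ v ∈ U', z p p v = 0 ∧ ∀ i, p ≤ i → i < n → z i p v = 0 := by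
    intro n hn
    induction n, hn using Nat.le_induction with
    | base =>
      intro _
      obtain ⟨U', h1, h2, h3⟩ := corner
      refine ⟨U', h1, h2, fun v hv => ⟨h3 v hv, fun i hpi hip => ?_⟩⟩
      obtain rfl : i = p := by omega
      exact h3 v hv
    | succ n hn ih =>
      intro hnN
      obtain ⟨U', h1, h2, h3⟩ := ih (by omega)
      obtain ⟨h4, h5⟩ := h1.inf_ker_of_normal h2
        (R.isNilpotent n p (by omega) hp (by omega)) (h1.mapsTo n p (by omega) hp)
        fun d b hd hb => h1.column_normal hz hQ hp.1 hn (by omega)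
          (fun i hpi hin v hv => (h3 v hv).2 i hpi hin) hd hb
      refine ⟨_, h4, h5, fun v hv => ⟨(h3 v hv.1).1, fun i hpi hin => ?_⟩⟩
      rcases Nat.lt_succ_iff_lt_or_eq.1 hin with h | rfl
      · exact (h3 v hv.1).2 i hpi h
      · exact hv.2
  have rows : ∀ n, p + 1 ≤ n → n ≤ N + 1 → ∃ U', SupportedFrom N z p U' ∧
      HasWeight N z c U' ∧ ∀ v ∈ U', (∀ i, p ≤ i → i < N + 1 → z i p v = 0) ∧
        ∀ i, p ≤ i → i < n → z p i v = 0 := by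
    intro n hn
    induction n, hn using Nat.le_induction with
    | base =>
      intro _
      obtain ⟨U', h1, h2, h3⟩ := columns (N + 1) (by omega) le_rfl
      refine ⟨U', h1, h2, fun v hv => ⟨(h3 v hv).2, fun i hpi hip => ?_⟩⟩
      obtain rfl : i = p := by omega
      exact (h3 v hv).1
    | succ n hn ih =>
      intro hnN
      obtain ⟨U', h1, h2, h3⟩ := ih (by omega)
      obtain ⟨h4, h5⟩ := h1.inf_ker_of_normal h2
        (R.isNilpotent p n hp (by omega) (by omega)) (h1.mapsTo p n hp (by omega))
        fun d b hd hb => h1.row_normal hz hQ hp.1 hn (by omega)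
          (fun i hpi hin v hv => (h3 v hv).2 i hpi hin) hd hb
      refine ⟨_, h4, h5, fun v hv => ⟨(h3 v hv.1).1, fun i hpi hin => ?_⟩⟩
      rcases Nat.lt_succ_iff_lt_or_eq.1 hin with h | rfl
      · exact (h3 v hv.1).2 i hpi h
      · exact hv.2
  obtain ⟨U', h1, h2, h3⟩ := rows (N + 1) (by omega) le_rfl
  refine ⟨U', ⟨h1.mapsTo, fun i j hi hj hij v hv => ?_⟩, h2⟩
  by_cases hlow : i < p ∨ j < p
  · exact h1.eq_zero i j hi hj hlow v hv
  · by_cases hj' : j = p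
    · subst hj'
      exact (h3 v hv).1 i (by omega) (by omega)
    · obtain rfl : i = p := by omega
      exact (h3 v hv).2 j (by omega) (by omega)

/-- The weight is that of the counit when the corner operator is invertible on it. -/
theorem weight_eq_of_corner_ne_zero [FiniteDimensional ℂ W] (hs : 1 ≤ s) {U : Submodule ℂ W}
    (hU : SupportedFrom N z p U) (hp : 1 ≤ p ∧ p ≤ N) {c : ℕ → ℂ} (hc : HasWeight N z c U)
    (hcp : c p ≠ 0) {i : ℕ} (hi : 1 ≤ i ∧ i ≤ N) :
    c i = if N < i + s then Q ^ (2 * i) * (Q ^ (2 * N + 1))⁻¹ else 0 := by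
  have hQ := R.ne_zero
  obtain ⟨v, hv, hv0, hvc⟩ := hc
  obtain ⟨hsp, hcp'⟩ := R.corner_eigenvalue_eq hs hU hp hv hv0 (hvc p hp) hcp
  have hcol : ∀ n, p < n → n ≤ N → z n p v = 0 := by
    intro n hpn hn
    by_contra h0
    have h := hU.corner_column R.reflectionRel hQ hp.1 hpn hn hv
    rw [hvc p hp, map_smul, smul_smul] at h
    have h1 := (R.corner_eigenvalue_eq hs hU hp (hU.mapsTo n p (by omega) hp v hv) h0 h
      (mul_ne_zero (pow_ne_zero 2 hQ) hcp)).2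
    exact R.sq_ne_one (mul_right_cancel₀ hcp (by rw [h1, one_mul, hcp']))
  have hrow : ∀ n, p < n → n ≤ N → z p n v = 0 := by
    intro n hpn hn
    by_contra h0
    have h := hU.corner_row R.reflectionRel hQ hp.1 hpn hn hv
    rw [hvc p hp, map_smul, ← inv_smul_eq_iff₀ (pow_ne_zero 2 hQ), smul_smul] at h
    have h1 := (R.corner_eigenvalue_eq hs hU hp (hU.mapsTo p n hp (by omega) v hv) h0 h.symm
      (mul_ne_zero (inv_ne_zero (pow_ne_zero 2 hQ)) hcp)).2
    exact inv_ne_one.2 R.sq_ne_one (mul_right_cancel₀ hcp (by rw [h1, one_mul, hcp']))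
  split_ifs with his
  · rcases eq_or_lt_of_le (by omega : p ≤ i) with rfl | hpi
    · exact hcp'
    · have h := hU.column_row R.reflectionRel hp.1 hpi hi.2 hpi hi.2 hv
      rw [hcol i hpi hi.2, hrow i hpi hi.2, hvc i hi, map_smul, hvc p hp,
        partialProd_apply_eq_of_le (b := p + 1) (by omega) (by omega) fun n hn hni => by
          rw [hcol n hn (by omega), map_zero],
        partialProd_succ_apply hp.1, hU.partialProd_eq_zero hp.2 le_rfl hp hp hv, hvc p hp,
        map_smul, hvc p hp] at h
      simp only [map_zero, smul_zero, zero_add, if_true, smul_smul] at h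
      have h := smul_left_injective ℂ hv0 h
      have hQ' : Q - Q⁻¹ ≠ 0 := fun h0 => R.sq_ne_one (by
        field_simp at h0
        linear_combination h0)
      refine mul_left_cancel₀ (mul_ne_zero hQ' hcp) ?_
      have hcp'' : (Q ^ (2 * p))⁻¹ * c p = (Q ^ (2 * N + 1))⁻¹ := by
        rw [hcp']
        field_simp
      linear_combination h + (Q - Q⁻¹) * Q ^ (2 * i) * c p * hcp''
  · have h := hvc i hi
    rw [hU.eq_zero i i hi hi (by omega) v hv] at h
    exact (smul_eq_zero.1 h.symm).resolve_right hv0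

theorem weight_eq [FiniteDimensional ℂ W] (hs : 1 ≤ s) {c : ℕ → ℂ} {i : ℕ} (hi : 1 ≤ i ∧ i ≤ N)
    (t : ℕ) {U : Submodule ℂ W} (hU : SupportedFrom N z p U) (hp : 1 ≤ p)
    (hpt : p + s + t = N + 2) (hc : HasWeight N z c U) :
    c i = if N < i + s then Q ^ (2 * i) * (Q ^ (2 * N + 1))⁻¹ else 0 := by
  induction t generalizing p U with
  | zero =>
    obtain ⟨v, hv, hv0, -⟩ := hc
    have := R.add_le_of_supportedFrom hs hU (Submodule.ne_bot_iff _ |>.2 ⟨v, hv, hv0⟩)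
    omega
  | succ t ih =>
    by_cases hcp : c p = 0
    · obtain ⟨U', hU', hc'⟩ := R.exists_supportedFrom_succ hU (by omega) hc hcp
      exact ih hU' (by omega) (by omega) hc'
    · exact R.weight_eq_of_corner_ne_zero hs hU (by omega) hc hcp hi

end NilpotentGrassRep

/-- An operator whose only eigenvalue is `μ` is `μ` plus a nilpotent operator. -/
theorem isNilpotent_sub_of_eigenvalue_eq [FiniteDimensional ℂ W] {A : Module.End ℂ W} {μ : ℂ}
    (h : ∀ ν, A.HasEigenvalue ν → ν = μ) :
    IsNilpotent (A - algebraMap ℂ (Module.End ℂ W) μ) := by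
  have htop : A.maxGenEigenspace μ = ⊤ := by
    rw [← top_le_iff, ← Module.End.iSup_maxGenEigenspace_eq_top A]
    refine iSup_le fun ν => ?_
    by_cases hν : A.HasEigenvalue ν
    · rw [h ν hν]
    · rw [Module.End.HasEigenvalue, Module.End.hasUnifEigenvalue_iff_hasUnifEigenvalue_one
        (k := ⊤) (by simp) |>.not.symm, Module.End.HasUnifEigenvalue, not_not] at hν
      exact hν.le.trans bot_le
  refine ⟨Module.finrank ℂ W, LinearMap.ext fun w => ?_⟩
  have hw : w ∈ A.maxGenEigenspace μ := htop ▸ Submodule.mem_top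
  rw [Module.End.maxGenEigenspace_eq_genEigenspace_finrank, Module.End.mem_genEigenspace_nat] at hw
  rw [LinearMap.zero_apply, Algebra.algebraMap_eq_smul_one]
  exact hw

open scoped IsMulCommutative in
theorem exists_forall_length_prod_eq_zero [FiniteDimensional ℂ W] {B : Type*} [Ring B]
    [Algebra ℂ B] (ρ : B →ₐ[ℂ] Module.End ℂ W) (ε : B →ₐ[ℂ] ℂ) (T : Set B)
    (hcomm : ∀ a ∈ T, ∀ b ∈ T, ρ a * ρ b = ρ b * ρ a)
    (hnil : ∀ a ∈ T, IsNilpotent (ρ a - algebraMap ℂ (Module.End ℂ W) (ε a))) :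
    ∃ n : ℕ, ∀ l : List B, (∀ x ∈ l, x ∈ Algebra.adjoin ℂ T ∧ ε x = 0) →
      l.length = n → ρ l.prod = 0 := by
  let C := Algebra.adjoin ℂ (ρ '' T)
  have : IsMulCommutative C := Algebra.isMulCommutative_adjoin ℂ (by
    rintro _ ⟨a, ha, rfl⟩ _ ⟨b, hb, rfl⟩
    exact hcomm a ha b hb)
  have : IsNoetherianRing C := IsNoetherianRing.of_finite ℂ C
  obtain ⟨n, hn⟩ := IsNoetherianRing.isNilpotent_nilradical C
  have lift : ∀ x ∈ Algebra.adjoin ℂ T, ∃ y : C, (y : Module.End ℂ W) = ρ x ∧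
      y - algebraMap ℂ C (ε x) ∈ nilradical C := by
    intro x hx
    induction hx using Algebra.adjoin_induction with
    | mem x hx =>
      refine ⟨⟨ρ x, Algebra.subset_adjoin ⟨x, hx, rfl⟩⟩, rfl, mem_nilradical.2 ?_⟩
      obtain ⟨k, hk⟩ := hnil x hx
      exact ⟨k, Subtype.ext hk⟩
    | algebraMap c =>
      refine ⟨algebraMap ℂ C c, by rw [AlgHom.commutes]; rfl, ?_⟩
      rw [AlgHom.commutes, Algebra.algebraMap_self_apply, sub_self]
      exact zero_mem _
    | add x y _ _ hx hy =>
      obtain ⟨a, ha, ha'⟩ := hx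
      obtain ⟨b, hb, hb'⟩ := hy
      refine ⟨a + b, by rw [map_add, ← ha, ← hb]; rfl, ?_⟩
      rw [map_add, map_add, add_sub_add_comm]
      exact add_mem ha' hb'
    | mul x y _ _ hx hy =>
      obtain ⟨a, ha, ha'⟩ := hx
      obtain ⟨b, hb, hb'⟩ := hy
      refine ⟨a * b, by rw [map_mul, ← ha, ← hb]; rfl, ?_⟩
      have : a * b - algebraMap ℂ C (ε (x * y)) = a * (b - algebraMap ℂ C (ε y)) +
          algebraMap ℂ C (ε y) * (a - algebraMap ℂ C (ε x)) := by
        rw [map_mul, map_mul]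
        ring
      rw [this]
      exact add_mem (Ideal.mul_mem_left _ _ hb') (Ideal.mul_mem_left _ _ ha')
  refine ⟨n, fun l hl hln => ?_⟩
  have key : ∀ l : List B, (∀ x ∈ l, x ∈ Algebra.adjoin ℂ T ∧ ε x = 0) →
      ∃ y ∈ nilradical C ^ l.length, (y : Module.End ℂ W) = ρ l.prod := by
    intro l
    induction l with
    | nil => exact fun _ => ⟨1, by simp, by rw [List.prod_nil, map_one]; rfl⟩
    | cons x l ih =>
      intro h
      obtain ⟨y, hy, hyl⟩ := ih fun x hx => h x (List.mem_cons_of_mem _ hx)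
      obtain ⟨hx, hx0⟩ := h x List.mem_cons_self
      obtain ⟨a, ha, ha'⟩ := lift x hx
      rw [hx0, map_zero, sub_zero] at ha'
      refine ⟨a * y, ?_, by rw [List.prod_cons, map_mul, ← ha, ← hyl]; rfl⟩
      rw [List.length_cons, pow_succ']
      exact Ideal.mul_mem_mul ha' hy
  obtain ⟨y, hy, hyl⟩ := key l hl
  rw [hln, hn] at hy
  rw [← hyl, (Ideal.mem_bot.1 hy : y = 0)]
  rfl

theorem GrassRels.map {q : ℝ} {N r : ℕ} {V V' : Type} [Ring V] [Algebra ℂ V] [Ring V']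
    [Algebra ℂ V'] {z : ℕ → ℕ → V} (h : GrassRels q N r z) (f : V →ₐ[ℂ] V') :
    GrassRels q N r fun i j => f (z i j) := by
  refine ⟨fun a ha b hb c hc d hd => ?_, ?_, fun i hi k hk => ?_⟩
  · simpa only [map_sum, map_smul, map_mul] using congrArg f (h.1 a ha b hb c hc d hd)
  · simpa only [map_sum, AlgHom.commutes] using congrArg f h.2.1
  · simpa only [map_sum, map_smul, map_mul] using congrArg f (h.2.2 i hi k hk)

theorem zpow_injective_ofReal {q : ℝ} (hq₁ : q ≠ -1) (hq₂ : q ≠ 0) (hq₃ : q ≠ 1) :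
    Function.Injective fun n : ℤ => (q : ℂ) ^ n := by
  intro m n h
  have h : q ^ m = q ^ n := by
    have h : (q : ℂ) ^ m = (q : ℂ) ^ n := h
    exact_mod_cast h
  refine zpow_right_injective₀ (abs_pos.2 hq₂) (fun h1 => ?_) (by
    simpa only [abs_zpow] using congrArg abs h : |q| ^ m = |q| ^ n)
  rcases eq_or_eq_neg_of_abs_eq h1 with h | h
  · exact hq₃ h
  · exact hq₁ h

theorem GrassRels.nilpotentGrassRep {W : Type} [AddCommGroup W] [Module ℂ W] {q : ℝ} (hq₁ : q ≠ -1)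
    (hq₂ : q ≠ 0) (hq₃ : q ≠ 1) {N r : ℕ} (hr : r ≤ N) {z : ℕ → ℕ → Module.End ℂ W}
    (h : GrassRels q N r z)
    (hnil : ∀ i ∈ Icc 1 N, ∀ j ∈ Icc 1 N, i ≠ j → IsNilpotent (z i j)) :
    NilpotentGrassRep (q : ℂ) N (N - r) z := by
  have hQ : (q : ℂ) ≠ 0 := by exact_mod_cast hq₂
  have hinj := zpow_injective_ofReal hq₁ hq₂ hq₃
  have hQ' : (q : ℂ) - (q : ℂ)⁻¹ ≠ 0 := fun h0 => by
    have : (1 : ℤ) = -1 := hinj (by simpa using sub_eq_zero.1 h0)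
    omega
  refine ⟨hQ, hinj, h.reflectionRel hq₂, fun v => ?_, fun i k hi hk v => ?_,
    fun i j hi hj => hnil i (mem_Icc.2 hi) j (mem_Icc.2 hj)⟩
  · have ht := congrArg (fun A : Module.End ℂ W => ((q : ℂ) - (q : ℂ)⁻¹) • A v) h.2.1
    simp only [LinearMap.sum_apply, Module.algebraMap_end_apply, smul_smul] at ht
    rw [ht, mul_div_cancel₀ _ hQ', neg_mul, zpow_neg, ← Nat.cast_sub hr]
    norm_cast
  · have hp := congrArg (fun A : Module.End ℂ W => A v) (h.2.2 i (mem_Icc.2 hi) k (mem_Icc.2 hk))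
    have hI : Ico 1 (N + 1) = Icc 1 N := by
      ext x
      simp only [mem_Ico, mem_Icc]
      omega
    rw [← hp, partialProd_apply, hI]
    simp only [LinearMap.smul_apply, LinearMap.sum_apply, Module.End.mul_apply, neg_mul, zpow_neg]
    norm_cast
    rw [smul_smul, inv_mul_cancel₀ (pow_ne_zero _ hq₂), one_smul]

theorem NilpotentGrassRep.apply_eq [FiniteDimensional ℂ W] (R : NilpotentGrassRep Q N s z)
    (hs : 1 ≤ s) (hsN : s ≤ N) {v : W} (hv0 : v ≠ 0)
    (hv : ∀ i, 1 ≤ i ∧ i ≤ N → ∃ c : ℂ, z i i v = c • v) {i : ℕ} (hi : 1 ≤ i ∧ i ≤ N) :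
    z i i v = (if N < i + s then Q ^ (2 * i) * (Q ^ (2 * N + 1))⁻¹ else 0) • v := by
  choose! c hc using hv
  rw [hc i hi, R.weight_eq hs hi (N + 1 - s) (p := 1) (U := ⊤)
    ⟨fun _ _ _ _ _ _ => Submodule.mem_top, fun i j hi hj => by omega⟩ le_rfl (by omega)
    ⟨v, Submodule.mem_top, hv0, hc⟩]

end Operators

/-- Lemma `nullnilp`.  Let `W` be a finite-dimensional representation
of `B = O_q(Gr(r,N))` on which all off-diagonal generators `z_{ij}` (`i ≠ j`) act
nilpotently.  Then the commutative nonunital subring `V₀⁺ ⊂ B⁺` also acts nilpotently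
on `W`; in fact every common eigenvector `v` of the `z_{ii}` satisfies
`(z_{ii} - ε(z_{ii}))v = 0` for all `i`. -/
theorem V0plus_acts_nilpotently
    (q : ℝ) (hq₁ : q ≠ -1) (hq₂ : q ≠ 0) (hq₃ : q ≠ 1)
    (N r : ℕ) (hN : 2 ≤ N) (hr1 : 1 ≤ r) (hr2 : r ≤ N - 1)
    (G : QGrassData q N r)
    (W : Type) [AddCommGroup W] [Module ℂ W] [FiniteDimensional ℂ W]
    (ρ : G.B →ₐ[ℂ] Module.End ℂ W)
    (hnil : ∀ i ∈ Finset.Icc 1 N, ∀ j ∈ Finset.Icc 1 N, i ≠ j →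
      IsNilpotent (ρ (G.z i j))) :
    (∃ n : ℕ, ∀ l : List G.B,
      (∀ x ∈ l, x ∈ Algebra.adjoin ℂ
          {y : G.B | ∃ i ∈ Finset.Icc 1 N, y = G.z i i} ∧ G.counit x = 0) →
      l.length = n → ρ l.prod = 0) ∧
    (∀ v : W, v ≠ 0 →
      (∀ i ∈ Finset.Icc 1 N, ∃ c : ℂ, ρ (G.z i i) v = c • v) →
      ∀ i ∈ Finset.Icc 1 N, ρ (G.z i i) v = G.counit (G.z i i) • v) := by
  have hR := (G.rels.map ρ).nilpotentGrassRep hq₁ hq₂ hq₃ (by omega) hnil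
  have hε : ∀ i ∈ Icc 1 N, (if N < i + (N - r) then (q : ℂ) ^ (2 * i) *
      ((q : ℂ) ^ (2 * N + 1))⁻¹ else 0) = G.counit (G.z i i) := by
    intro i hi
    rw [G.counit_z i hi i hi, zpow_sub₀ hR.ne_zero, div_eq_mul_inv]
    norm_cast
    simp only [true_and, (by omega : N < i + (N - r) ↔ r < i)]
  have heig : ∀ v : W, v ≠ 0 →
      (∀ i ∈ Icc 1 N, ∃ c : ℂ, ρ (G.z i i) v = c • v) →
      ∀ i ∈ Icc 1 N, ρ (G.z i i) v = G.counit (G.z i i) • v := by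
    intro v hv0 hv i hi
    rw [← hε i hi]
    exact hR.apply_eq (by omega) (by omega) hv0 (fun i hi => hv i (mem_Icc.2 hi)) (mem_Icc.1 hi)
  have hcomm : ∀ i ∈ Icc 1 N, ∀ j ∈ Icc 1 N, ∀ w,
      ρ (G.z i i) (ρ (G.z j j) w) = ρ (G.z j j) (ρ (G.z i i) w) := fun i hi j hj w =>
    hR.reflectionRel.diag_comm (mem_Icc.1 hi) (mem_Icc.1 hj) w
  refine ⟨exists_forall_length_prod_eq_zero ρ G.counit _ ?_ ?_, heig⟩
  · rintro _ ⟨i, hi, rfl⟩ _ ⟨j, hj, rfl⟩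
    exact LinearMap.ext (hcomm i hi j hj)
  · rintro _ ⟨i, hi, rfl⟩
    refine isNilpotent_sub_of_eigenvalue_eq fun ν hν => ?_
    obtain ⟨v, hv, hv0, hc⟩ := exists_common_eigenvector (Icc 1 N) (fun j => ρ (G.z j j)) hcomm
      (Module.End.eigenspace (ρ (G.z i i)) ν) hν fun j hj w hw => by
        rw [Module.End.mem_eigenspace_iff] at hw ⊢
        rw [hcomm i hi j hj, hw, map_smul]
    rw [Module.End.mem_eigenspace_iff] at hv
    exact smul_left_injective ℂ hv0 (hv.symm.trans (heig v hv0 hc i hi))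
end
end
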